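/- arXiv:2304.07088 — 7 statements merged into one kernel-verified Lean document; each statement's English description precedes it below -/
import Mathlib

section
/- Let a : [0,1] → ℝ be continuous with a(x) > 0 for all x ∈ (0,1] (a(0) may vanish), and let C > 0 be a constant such that ∫₀¹ v(x)²/a(x) dx ≤ C ∫₀¹ v'(x)² dx for every v ∈ C¹([0,1]) with v(0) = 0. Then for every u ∈ C²([0,1]) with u(0) = 0 and u'(0) = 0 one has ∫₀¹ u(x)²/a(x) dx ≤ 4C ∫₀¹ u''(x)² dx. -/
open MeasureTheory intervalIntegral

/-- A Poincaré inequality on `[0, 1]` for functions vanishing at the left endpoint. -/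
theorem integral_sq_le_four_mul_integral_deriv_sq {z z' : ℝ → ℝ}
    (hz : ∀ x ∈ Set.Icc (0:ℝ) 1, HasDerivAt z (z' x) x)
    (hz' : ContinuousOn z' (Set.Icc 0 1)) (hz0 : z 0 = 0) :
    (∫ x in (0:ℝ)..1, (z x) ^ 2) ≤ 4 * ∫ x in (0:ℝ)..1, (z' x) ^ 2 := by
  have hI : Set.uIcc (0:ℝ) 1 = Set.Icc 0 1 := Set.uIcc_of_le zero_le_one
  have hzc : ContinuousOn z (Set.Icc 0 1) :=
    fun x hx => (hz x hx).continuousAt.continuousWithinAt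
  have hint {f : ℝ → ℝ} (hf : ContinuousOn f (Set.Icc 0 1)) :
      IntervalIntegrable f volume 0 1 :=
    ContinuousOn.intervalIntegrable (hI ▸ hf)
  have hF := hint (f := fun x => (z x) ^ 2 + (x - 1) * (2 * z x * z' x)) (by fun_prop)
  have h₁ := hint (f := fun x => (1 / 2) * (z x) ^ 2) (by fun_prop)
  have h₂ := hint (f := fun x => 2 * (z' x) ^ 2) (by fun_prop)
  have hzero : (∫ x in (0:ℝ)..1, ((z x) ^ 2 + (x - 1) * (2 * z x * z' x))) = 0 := by
    rw [integral_eq_sub_of_hasDerivAt (f := fun x => (x - 1) * (z x) ^ 2) _ hF]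
    · simp [hz0]
    · intro x hx
      exact (((hasDerivAt_id x).sub_const 1).mul ((hz x (hI ▸ hx)).pow 2)).congr_deriv (by simp)
  have hle : (∫ x in (0:ℝ)..1, ((1 / 2) * (z x) ^ 2 - 2 * (z' x) ^ 2)) ≤
      ∫ x in (0:ℝ)..1, ((z x) ^ 2 + (x - 1) * (2 * z x * z' x)) := by
    refine integral_mono_on zero_le_one (h₁.sub h₂) hF fun x hx => ?_
    have hx2 : (x - 1) ^ 2 ≤ 1 := by nlinarith [hx.1, hx.2]
    nlinarith [sq_nonneg (z x + 2 * (x - 1) * z' x),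
      mul_le_mul_of_nonneg_right hx2 (sq_nonneg (z' x))]
  rw [hzero, integral_sub h₁ h₂, intervalIntegral.integral_const_mul,
    intervalIntegral.integral_const_mul] at hle
  linarith

/-- Proposition 2.2, case i = 2: weighted Hardy inequality iterated via the classical
Hardy inequality gives `∫ u²/a ≤ 4C ∫ (u'')²` for `u ∈ C²` with `u(0) = u'(0) = 0`. -/
theorem stmt0
    (a : ℝ → ℝ) (C : ℝ)
    (ha_cont : ContinuousOn a (Set.Icc 0 1))
    (ha_pos : ∀ x ∈ Set.Ioc (0:ℝ) 1, 0 < a x)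
    (hC : 0 < C)
    (hHardy : ∀ v v' : ℝ → ℝ,
      (∀ x ∈ Set.Icc (0:ℝ) 1, HasDerivAt v (v' x) x) →
      ContinuousOn v' (Set.Icc 0 1) → v 0 = 0 →
      (∫ x in (0:ℝ)..1, (v x) ^ 2 / a x) ≤ C * ∫ x in (0:ℝ)..1, (v' x) ^ 2)
    (u u' u'' : ℝ → ℝ)
    (hu' : ∀ x ∈ Set.Icc (0:ℝ) 1, HasDerivAt u (u' x) x)
    (hu'' : ∀ x ∈ Set.Icc (0:ℝ) 1, HasDerivAt u' (u'' x) x)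
    (hu''_cont : ContinuousOn u'' (Set.Icc 0 1))
    (hu0 : u 0 = 0) (hu'0 : u' 0 = 0) :
    (∫ x in (0:ℝ)..1, (u x) ^ 2 / a x) ≤ 4 * C * ∫ x in (0:ℝ)..1, (u'' x) ^ 2 := by
  have h := hHardy u u' hu'
    (fun x hx => (hu'' x hx).continuousAt.continuousWithinAt) hu0
  have hP := mul_le_mul_of_nonneg_left
    (integral_sq_le_four_mul_integral_deriv_sq hu'' hu''_cont hu'0) hC.le
  linarith
end

section
/- Let a : (0,1] → ℝ be positive, let K ∈ (0,2), and suppose x ↦ x^K/a(x) is nondecreasing on (0,1]. Let u : (0,1) → ℝ be measurable with ∫₀¹ a(x) u(x)² dx < +∞. Then lim_{δ→0⁺} δ ∫_δ¹ |u(x)| dx = 0. -/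
open MeasureTheory intervalIntegral

/-- If `x * |u x|` is integrable on `(0, 1]`, then `δ ∫_δ¹ |u| → 0` as `δ → 0⁺`. -/
theorem tendsto_mul_integral_abs_of_integrableOn_mul_abs {u : ℝ → ℝ} (hu : Measurable u)
    (hint : IntegrableOn (fun x => x * |u x|) (Set.Ioc 0 1)) :
    Filter.Tendsto (fun δ => δ * ∫ x in δ..1, |u x|)
      (nhdsWithin 0 (Set.Ioi 0)) (nhds 0) := by
  have key : Filter.Tendsto
      (fun δ : ℝ => ∫ x in Set.Ioc (0:ℝ) 1, (Set.Ioc δ 1).indicator (fun x => δ * |u x|) x)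
      (nhdsWithin 0 (Set.Ioi 0)) (nhds (∫ _ in Set.Ioc (0:ℝ) 1, (0:ℝ))) := by
    refine tendsto_integral_filter_of_dominated_convergence (fun x => x * |u x|) ?_ ?_ hint ?_
    · exact .of_forall fun δ =>
        ((hu.abs.const_mul δ).indicator measurableSet_Ioc).aestronglyMeasurable
    · filter_upwards [self_mem_nhdsWithin] with δ hδ
      refine (ae_restrict_iff' measurableSet_Ioc).2 (.of_forall fun x hx => ?_)
      by_cases h : x ∈ Set.Ioc δ 1
      · rw [Set.indicator_of_mem h, Real.norm_eq_abs,
          abs_of_nonneg (mul_nonneg (le_of_lt hδ) (abs_nonneg _))]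
        exact mul_le_mul_of_nonneg_right h.1.le (abs_nonneg _)
      · rw [Set.indicator_of_notMem h, norm_zero]
        exact mul_nonneg hx.1.le (abs_nonneg _)
    · refine (ae_restrict_iff' measurableSet_Ioc).2 (.of_forall fun x hx => ?_)
      have hlim : Filter.Tendsto (fun δ : ℝ => δ * |u x|) (nhdsWithin 0 (Set.Ioi 0)) (nhds 0) := by
        have h : Filter.Tendsto (fun δ : ℝ => δ * |u x|) (nhds 0) (nhds (0 * |u x|)) :=
          Filter.tendsto_id.mul_const _
        rw [zero_mul] at h
        exact h.mono_left nhdsWithin_le_nhds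
      refine hlim.congr' ?_
      filter_upwards [mem_nhdsWithin_of_mem_nhds (Iio_mem_nhds hx.1)] with δ hδ
      rw [Set.indicator_of_mem (show x ∈ Set.Ioc δ 1 from ⟨hδ, hx.2⟩)]
  rw [integral_zero] at key
  refine key.congr' ?_
  filter_upwards [self_mem_nhdsWithin, mem_nhdsWithin_of_mem_nhds (Iio_mem_nhds one_pos)]
    with δ hδ0 hδ1
  rw [setIntegral_indicator measurableSet_Ioc,
    Set.inter_eq_right.2 (Set.Ioc_subset_Ioc_left (le_of_lt hδ0)),
    integral_of_le (le_of_lt hδ1), MeasureTheory.integral_const_mul]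

/-- Key estimate in the strongly degenerate case: if `√a · u ∈ L²(0,1)` and
`x ↦ x^K/a(x)` is nondecreasing with `K < 2`, then `δ ∫_δ¹ |u| → 0` as `δ → 0⁺`. -/
theorem stmt6
    (a : ℝ → ℝ) (K : ℝ) (u : ℝ → ℝ)
    (ha_pos : ∀ x ∈ Set.Ioc (0:ℝ) 1, 0 < a x)
    (hK0 : 0 < K) (hK2 : K < 2)
    (hmono : MonotoneOn (fun x => x ^ K / a x) (Set.Ioc 0 1))
    (hu_meas : Measurable u)
    (hfin : IntegrableOn (fun x => a x * (u x) ^ 2) (Set.Ioc 0 1)) :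
    Filter.Tendsto (fun δ => δ * ∫ x in δ..1, |u x|)
      (nhdsWithin 0 (Set.Ioi 0)) (nhds 0) := by
  refine tendsto_mul_integral_abs_of_integrableOn_mul_abs hu_meas ?_
  have hone : (1:ℝ) ∈ Set.Ioc (0:ℝ) 1 := ⟨one_pos, le_rfl⟩
  have h1 : 0 < a 1 := ha_pos 1 hone
  have hconst : IntegrableOn (fun _ => (1:ℝ)) (Set.Ioc (0:ℝ) 1) :=
    integrableOn_const (by simp)
  refine Integrable.mono' (hconst.add (hfin.const_mul (a 1)⁻¹))
    (measurable_id.mul hu_meas.abs).aestronglyMeasurable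
    ((ae_restrict_iff' measurableSet_Ioc).2 (.of_forall fun x hx => ?_))
  have hax := ha_pos x hx
  have hweight : x ^ K ≤ (a 1)⁻¹ * a x := by
    have h := hmono hx hone hx.2
    simp only [Real.one_rpow, one_div] at h
    exact (div_le_iff₀ hax).1 h
  have hpow : x ^ 2 ≤ x ^ K := by
    rw [← Real.rpow_two]
    exact Real.rpow_le_rpow_of_exponent_ge hx.1 hx.2 hK2.le
  have hsq : x ^ 2 * u x ^ 2 ≤ (a 1)⁻¹ * (a x * u x ^ 2) := by
    rw [← mul_assoc]
    exact mul_le_mul_of_nonneg_right (hpow.trans hweight) (sq_nonneg _)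
  have habs : (x * |u x|) ^ 2 = x ^ 2 * u x ^ 2 := by rw [mul_pow, sq_abs]
  rw [Real.norm_eq_abs, abs_of_nonneg (mul_nonneg hx.1.le (abs_nonneg _))]
  change x * |u x| ≤ 1 + (a 1)⁻¹ * (a x * u x ^ 2)
  nlinarith [sq_nonneg (x * |u x| - 1)]
end

section
/- Let β ≥ 0, γ ≥ 0 and λ, μ ∈ ℝ. Then there exists a unique pair (A,B) ∈ ℝ² such that the cubic polynomial z(x) := A x² + B x³ satisfies β z(1) − z'''(1) = λ and γ z'(1) + z''(1) = μ. Moreover this z satisfies ∫₀¹ z''(x)² dx + β z(1)² + γ z'(1)² ≤ (|λ| + |μ|)². -/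
open MeasureTheory intervalIntegral

/-- The cubic `z(x) = A x² + B x³`. -/
noncomputable def cubicZ (A B : ℝ) : ℝ → ℝ := fun x => A * x ^ 2 + B * x ^ 3

theorem deriv_cubicZ (A B : ℝ) : deriv (cubicZ A B) = fun x => 2 * A * x + 3 * B * x ^ 2 := by
  funext x
  have h : HasDerivAt (cubicZ A B) (A * (2 * x) + B * (3 * x ^ 2)) x := by
    unfold cubicZ
    simpa using ((hasDerivAt_pow 2 x).const_mul A).fun_add ((hasDerivAt_pow 3 x).const_mul B)
  rw [h.deriv]
  ring

theorem deriv_deriv_cubicZ (A B : ℝ) :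
    deriv (deriv (cubicZ A B)) = fun x => 2 * A + 6 * B * x := by
  rw [deriv_cubicZ]
  funext x
  have h : HasDerivAt (fun x : ℝ => 2 * A * x + 3 * B * x ^ 2)
      (2 * A * 1 + 3 * B * (2 * x)) x := by
    simpa using ((hasDerivAt_id x).const_mul (2 * A)).fun_add
      ((hasDerivAt_pow 2 x).const_mul (3 * B))
  rw [h.deriv]
  ring

theorem deriv_deriv_deriv_cubicZ (A B : ℝ) :
    deriv (deriv (deriv (cubicZ A B))) = fun _ => 6 * B := by
  rw [deriv_deriv_cubicZ]
  funext x
  have h : HasDerivAt (fun x : ℝ => 2 * A + 6 * B * x) (6 * B * 1) x :=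
    ((hasDerivAt_id x).const_mul (6 * B)).const_add (2 * A)
  rw [h.deriv, mul_one]

theorem integral_sq_deriv_deriv_cubicZ (A B : ℝ) :
    (∫ x in (0:ℝ)..1, (deriv (deriv (cubicZ A B)) x) ^ 2) =
      4 * A ^ 2 + 12 * A * B + 12 * B ^ 2 := by
  rw [deriv_deriv_cubicZ]
  have h (x : ℝ) : HasDerivAt
      (fun x : ℝ => 4 * A ^ 2 * x + 12 * A * B * x ^ 2 + 12 * B ^ 2 * x ^ 3)
      ((2 * A + 6 * B * x) ^ 2) x := by
    rw [show (2 * A + 6 * B * x) ^ 2 =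
      4 * A ^ 2 * 1 + 12 * A * B * (2 * x) + 12 * B ^ 2 * (3 * x ^ 2) by ring]
    simpa using (((hasDerivAt_id x).const_mul (4 * A ^ 2)).fun_add
      ((hasDerivAt_pow 2 x).const_mul (12 * A * B))).fun_add
      ((hasDerivAt_pow 3 x).const_mul (12 * B ^ 2))
  rw [integral_eq_sub_of_hasDerivAt (fun x _ => h x)
    (Continuous.intervalIntegrable (by fun_prop) 0 1)]
  ring

/-- A nonnegative energy `E = a p + b q` that controls `p²` and `q²` is at most `(|a| + |b|)²`. -/
theorem le_sq_abs_add_abs {E a b p q : ℝ} (hE : E = a * p + b * q)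
    (hp : p ^ 2 ≤ E) (hq : q ^ 2 ≤ E) : E ≤ (|a| + |b|) ^ 2 := by
  have hE0 : 0 ≤ E := (sq_nonneg p).trans hp
  have hp' : |p| ≤ √E := Real.abs_le_sqrt hp
  have hq' : |q| ≤ √E := Real.abs_le_sqrt hq
  have hle : E ≤ (|a| + |b|) * √E := by
    calc E = a * p + b * q := hE
      _ ≤ |a| * |p| + |b| * |q| := by
        rw [← abs_mul, ← abs_mul]
        exact add_le_add (le_abs_self _) (le_abs_self _)
      _ ≤ |a| * √E + |b| * √E := by gcongr
      _ = (|a| + |b|) * √E := by ring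
  nlinarith [Real.sq_sqrt hE0, sq_nonneg (|a| + |b| - √E)]

/-- Proposition 2.7: there is a unique pair `(A,B)` such that `z = Ax² + Bx³` satisfies
`β z(1) − z'''(1) = λ` and `γ z'(1) + z''(1) = μ`; moreover this `z` satisfies
`∫ (z'')² + β z(1)² + γ z'(1)² ≤ (|λ| + |μ|)²`. -/
theorem stmt7 (β γ lam μ : ℝ) (hβ : 0 ≤ β) (hγ : 0 ≤ γ) :
    (∃! p : ℝ × ℝ,
      β * cubicZ p.1 p.2 1 - deriv (deriv (deriv (cubicZ p.1 p.2))) 1 = lam ∧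
      γ * deriv (cubicZ p.1 p.2) 1 + deriv (deriv (cubicZ p.1 p.2)) 1 = μ) ∧
    (∀ A B : ℝ,
      (β * cubicZ A B 1 - deriv (deriv (deriv (cubicZ A B))) 1 = lam ∧
       γ * deriv (cubicZ A B) 1 + deriv (deriv (cubicZ A B)) 1 = μ) →
      (∫ x in (0:ℝ)..1, (deriv (deriv (cubicZ A B)) x) ^ 2)
          + β * (cubicZ A B 1) ^ 2 + γ * (deriv (cubicZ A B) 1) ^ 2
        ≤ (|lam| + |μ|) ^ 2) := by
  simp only [integral_sq_deriv_deriv_cubicZ, deriv_deriv_deriv_cubicZ]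
  simp only [deriv_deriv_cubicZ]
  simp only [deriv_cubicZ, cubicZ]
  refine ⟨?_, ?_⟩
  · have hD : 0 < β * γ + 4 * β + 12 * γ + 12 := by positivity
    refine ⟨((lam * (3 * γ + 6) - μ * (β - 6)) / (β * γ + 4 * β + 12 * γ + 12),
      (μ * β - lam * (2 * γ + 2)) / (β * γ + 4 * β + 12 * γ + 12)), ⟨?_, ?_⟩, ?_⟩
    · field_simp
      ring
    · field_simp
      ring
    · rintro ⟨A, B⟩ ⟨h₁, h₂⟩
      ext
      · rw [eq_div_iff hD.ne']
        linear_combination (3 * γ + 6) * h₁ - (β - 6) * h₂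
      · rw [eq_div_iff hD.ne']
        linear_combination β * h₂ - (2 * γ + 2) * h₁
  · rintro A B ⟨h₁, h₂⟩
    have hp := mul_nonneg hβ (sq_nonneg (A + B))
    have hq := mul_nonneg hγ (sq_nonneg (2 * A + 3 * B))
    apply le_sq_abs_add_abs (p := A + B) (q := 2 * A + 3 * B)
    · rw [← h₁, ← h₂]
      ring
    · nlinarith [sq_nonneg (3 * A + 5 * B), sq_nonneg B]
    · nlinarith [sq_nonneg B]
end

section
/- Let a : [0,1] → ℝ be continuous with a(x) > 0 for x ∈ (0,1], and let C_HP > 0 be a constant such that ∫₀¹ v(x)²/a(x) dx ≤ C_HP ∫₀¹ v'(x)² dx for every v ∈ C¹([0,1]) with v(0) = 0. Let β ≥ 0, γ ≥ 0, λ, μ ∈ ℝ, and let z(x) = A x² + B x³ be the unique cubic polynomial satisfying β z(1) − z'''(1) = λ and γ z'(1) + z''(1) = μ. Then ∫₀¹ z(x)²/a(x) dx ≤ (4 C_HP + 1)(|λ| + |μ|)². -/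
open MeasureTheory intervalIntegral

theorem hasDerivAt_cubicZ (A B x : ℝ) :
    HasDerivAt (cubicZ A B) (2 * A * x + 3 * B * x ^ 2) x := by
  unfold cubicZ
  refine (((hasDerivAt_pow 2 x).const_mul A).add ((hasDerivAt_pow 3 x).const_mul B)).congr_deriv ?_
  norm_num
  ring

theorem integral_deriv_cubicZ_sq (A B : ℝ) :
    ∫ x in (0:ℝ)..1, (2 * A * x + 3 * B * x ^ 2) ^ 2 =
      4 / 3 * A ^ 2 + 3 * A * B + 9 / 5 * B ^ 2 := by
  have hderiv : ∀ x ∈ Set.uIcc (0:ℝ) 1,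
      HasDerivAt (fun x => 4 / 3 * A ^ 2 * x ^ 3 + 3 * A * B * x ^ 4 + 9 / 5 * B ^ 2 * x ^ 5)
        ((2 * A * x + 3 * B * x ^ 2) ^ 2) x := by
    intro x _
    refine ((((hasDerivAt_pow 3 x).const_mul (4 / 3 * A ^ 2)).add
      ((hasDerivAt_pow 4 x).const_mul (3 * A * B))).add
      ((hasDerivAt_pow 5 x).const_mul (9 / 5 * B ^ 2))).congr_deriv ?_
    norm_num
    ring
  rw [integral_eq_sub_of_hasDerivAt hderiv (Continuous.intervalIntegrable (by fun_prop) _ _)]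
  ring

/-- The energy bound for the cubic, where `4 A² + 12 A B + 12 B² = ∫₀¹ (z'')²`. -/
theorem cubic_energy_le {β γ lam μ A B : ℝ} (hβ : 0 ≤ β) (hγ : 0 ≤ γ)
    (h₁ : β * (A + B) - 6 * B = lam) (h₂ : γ * (2 * A + 3 * B) + (2 * A + 6 * B) = μ) :
    4 * A ^ 2 + 12 * A * B + 12 * B ^ 2 ≤ (|lam| + |μ|) ^ 2 := by
  set S := 4 * A ^ 2 + 12 * A * B + 12 * B ^ 2 with hS
  have hS0 : 0 ≤ S := by nlinarith [sq_nonneg (2 * A + 3 * B), sq_nonneg B]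
  have hp : |A + B| ≤ √S := Real.abs_le_sqrt (by nlinarith [sq_nonneg (3 * A + 5 * B), sq_nonneg B])
  have hq : |2 * A + 3 * B| ≤ √S := Real.abs_le_sqrt (by nlinarith [sq_nonneg B])
  have henergy : S ≤ lam * (A + B) + μ * (2 * A + 3 * B) := by
    rw [← h₁, ← h₂]
    nlinarith [mul_nonneg hβ (sq_nonneg (A + B)), mul_nonneg hγ (sq_nonneg (2 * A + 3 * B))]
  have hlam : lam * (A + B) ≤ |lam| * √S :=
    (le_abs_self _).trans (by rw [abs_mul]; gcongr)
  have hμ : μ * (2 * A + 3 * B) ≤ |μ| * √S :=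
    (le_abs_self _).trans (by rw [abs_mul]; gcongr)
  have hsq : √S ^ 2 = S := Real.sq_sqrt hS0
  have hL : 0 ≤ |lam| + |μ| := by positivity
  nlinarith [sq_nonneg (|lam| + |μ| - √S)]

/-- First estimate in (2.4) of Proposition 2.7: the cubic solution `z` of the boundary
problem satisfies `∫ z²/a ≤ (4 C_HP + 1)(|λ| + |μ|)²`. -/
theorem stmt9
    (a : ℝ → ℝ) (CHP : ℝ)
    (ha_cont : ContinuousOn a (Set.Icc 0 1))
    (ha_pos : ∀ x ∈ Set.Ioc (0:ℝ) 1, 0 < a x)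
    (hCHP : 0 < CHP)
    (hHardy : ∀ v v' : ℝ → ℝ,
      (∀ x ∈ Set.Icc (0:ℝ) 1, HasDerivAt v (v' x) x) →
      ContinuousOn v' (Set.Icc 0 1) → v 0 = 0 →
      (∫ x in (0:ℝ)..1, (v x) ^ 2 / a x) ≤ CHP * ∫ x in (0:ℝ)..1, (v' x) ^ 2)
    (β γ lam μ A B : ℝ) (hβ : 0 ≤ β) (hγ : 0 ≤ γ)
    (hbc1 : β * cubicZ A B 1 - deriv (deriv (deriv (cubicZ A B))) 1 = lam)
    (hbc2 : γ * deriv (cubicZ A B) 1 + deriv (deriv (cubicZ A B)) 1 = μ) :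
    (∫ x in (0:ℝ)..1, (cubicZ A B x) ^ 2 / a x) ≤ (4 * CHP + 1) * (|lam| + |μ|) ^ 2 := by
  have henergy : 4 * A ^ 2 + 12 * A * B + 12 * B ^ 2 ≤ (|lam| + |μ|) ^ 2 := by
    rw [deriv_deriv_deriv_cubicZ] at hbc1
    rw [deriv_deriv_cubicZ, deriv_cubicZ] at hbc2
    exact cubic_energy_le hβ hγ (by simpa [cubicZ] using hbc1) (by simpa using hbc2)
  have h := hHardy (cubicZ A B) (fun x => 2 * A * x + 3 * B * x ^ 2)
    (fun x _ => hasDerivAt_cubicZ A B x) (Continuous.continuousOn (by fun_prop)) (by simp [cubicZ])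
  rw [integral_deriv_cubicZ_sq] at h
  have hle : 4 / 3 * A ^ 2 + 3 * A * B + 9 / 5 * B ^ 2 ≤ (|lam| + |μ|) ^ 2 := by
    nlinarith [sq_nonneg (16 * A + 27 * B), sq_nonneg B]
  calc _ ≤ CHP * (|lam| + |μ|) ^ 2 := h.trans (by gcongr)
    _ ≤ (4 * CHP + 1) * (|lam| + |μ|) ^ 2 := by gcongr; linarith
end

section
/- Let a be as in the degeneracy context and let y be a smooth classical solution of the degenerate beam problem on [0,T]×[0,1] with constants β ≥ 0, γ ≥ 0. Then for every 0 < s < T: 0 = 2∫₀¹ [∂_t y(t,x)·(x/a(x))·∂_x y(t,x)]_{t=s}^{t=T} dx − (1/a(1))∫ₛ^T (∂_t y(t,1))² dt + ∫ₛ^T∫₀¹ ((∂_t y)²/a)(1 − x a'(x)/a(x)) dx dt + 3∫ₛ^T∫₀¹ (∂_x² y)² dx dt + 2β∫ₛ^T ∂_x y(t,1)·y(t,1) dt + 2∫ₛ^T ∂_x y(t,1)·∂_t y(t,1) dt + 2γ∫ₛ^T (∂_x y(t,1))² dt + 2∫ₛ^T ∂_x y(t,1)·∂_t∂_x y(t,1)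 dt − ∫ₛ^T (∂_x² y(t,1))² dt. -/
open MeasureTheory intervalIntegral

lemma intervalIntegrable_of_continuousOn_Ioc_of_bounded {g : ℝ → ℝ} {C : ℝ}
    (hg : ContinuousOn g (Set.Ioc 0 1)) (hC : ∀ x ∈ Set.Ioc (0:ℝ) 1, |g x| ≤ C) :
    IntervalIntegrable g volume 0 1 := by
  rw [intervalIntegrable_iff_integrableOn_Ioc_of_le zero_le_one]
  refine ⟨hg.aestronglyMeasurable measurableSet_Ioc,
    .restrict_of_bounded (C := C) (by simp) ?_⟩
  filter_upwards [ae_restrict_mem measurableSet_Ioc] with x hx using hC x hx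

lemma integrableOn_prod_of_continuousOn_of_bounded {F : ℝ → ℝ → ℝ} {s T C : ℝ}
    (hF : ContinuousOn (fun p : ℝ × ℝ => F p.1 p.2) (Set.Icc s T ×ˢ Set.Ioc 0 1))
    (hC : ∀ t ∈ Set.Icc s T, ∀ x ∈ Set.Ioc (0:ℝ) 1, |F t x| ≤ C) :
    IntegrableOn F.uncurry (Set.Ioc s T ×ˢ Set.Ioc 0 1) := by
  have hms : MeasurableSet (Set.Ioc s T ×ˢ Set.Ioc (0:ℝ) 1) :=
    measurableSet_Ioc.prod measurableSet_Ioc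
  have hsub : Set.Ioc s T ×ˢ Set.Ioc (0:ℝ) 1 ⊆ Set.Icc s T ×ˢ Set.Ioc 0 1 :=
    Set.prod_mono Set.Ioc_subset_Icc_self subset_rfl
  refine ⟨(hF.mono hsub).aestronglyMeasurable hms, .restrict_of_bounded (C := C) ?_ ?_⟩
  · rw [Measure.volume_eq_prod, Measure.prod_prod]
    simp
  · filter_upwards [ae_restrict_mem hms] with p hp using hC _ (hsub hp).1 _ hp.2

lemma intervalIntegrable_integral_of_integrableOn_prod {F : ℝ → ℝ → ℝ} {s T : ℝ} (hsT : s ≤ T)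
    (hF : IntegrableOn F.uncurry (Set.Ioc s T ×ˢ Set.Ioc 0 1)) :
    IntervalIntegrable (fun t => ∫ x in (0:ℝ)..1, F t x) volume s T := by
  rw [intervalIntegrable_iff_integrableOn_Ioc_of_le hsT]
  rw [IntegrableOn, Measure.volume_eq_prod, ← Measure.prod_restrict] at hF
  simpa only [integral_of_le zero_le_one, Function.uncurry, IntegrableOn]
    using hF.integral_prod_left

lemma sq_div_le_of_degeneracy {a a' : ℝ → ℝ} {K : ℝ} (hK : K ≤ 2)
    (ha_pos : ∀ x ∈ Set.Ioc (0:ℝ) 1, 0 < a x)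
    (ha_deriv : ∀ x ∈ Set.Ioc (0:ℝ) 1, HasDerivAt a (a' x) x)
    (hKbound : ∀ x ∈ Set.Ioc (0:ℝ) 1, x * |a' x| ≤ K * a x)
    {x : ℝ} (hx : x ∈ Set.Ioc (0:ℝ) 1) : x ^ 2 / a x ≤ 1 / a 1 := by
  have hd : ∀ z ∈ Set.Ioc (0:ℝ) 1,
      HasDerivAt (fun z => z ^ 2 / a z) ((2 * z * a z - z ^ 2 * a' z) / a z ^ 2) z := by
    intro z hz
    simpa using (hasDerivAt_pow 2 z).fun_div (ha_deriv z hz) (ha_pos z hz).ne'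
  have hmono : MonotoneOn (fun z => z ^ 2 / a z) (Set.Ioc 0 1) := by
    refine monotoneOn_of_deriv_nonneg (convex_Ioc 0 1)
      (fun z hz => (hd z hz).continuousAt.continuousWithinAt)
      (fun z hz => (hd z (interior_subset hz)).differentiableAt.differentiableWithinAt) ?_
    intro z hz
    have hz := interior_subset hz
    rw [(hd z hz).deriv]
    have h1 := hKbound z hz
    have h2 := ha_pos z hz
    have h3 : z * a' z ≤ 2 * a z :=
      (mul_le_mul_of_nonneg_left (le_abs_self _) hz.1.le).trans (h1.trans (by gcongr))
    have h4 : 0 ≤ z * (2 * a z - z * a' z) := mul_nonneg hz.1.le (by linarith)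
    exact div_nonneg (by linarith) (by positivity)
  simpa using hmono hx (Set.right_mem_Ioc.2 zero_lt_one) hx.2

lemma abs_mul_div_mul_le {u v w x α C D M : ℝ} (hx : 0 < x) (hα : 0 < α) (hM : x ^ 2 / α ≤ M)
    (hw : w = x / α) (hu : |u| ≤ C * x) (hv : |v| ≤ D) : |u * w * v| ≤ C * M * D := by
  have hC : 0 ≤ C := nonneg_of_mul_nonneg_left ((abs_nonneg u).trans hu) hx
  have hw0 : 0 < w := hw ▸ div_pos hx hα
  rw [abs_mul, abs_mul, abs_of_pos hw0]
  have : |u| * w ≤ C * M :=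
    calc |u| * w ≤ C * x * w := by gcongr
      _ = C * (x ^ 2 / α) := by rw [hw]; ring
      _ ≤ C * M := by gcongr
  have hM0 : 0 ≤ M := le_trans (by positivity) hM
  gcongr

/-- Only the mixed derivative taken in the order "time, then space" is assumed to exist. -/
lemma hasDerivAt_space_deriv_time {T : ℝ} {y yt yx ytx : ℝ → ℝ → ℝ}
    (hyt : ∀ t ∈ Set.Icc (0:ℝ) T, ∀ x ∈ Set.Icc (0:ℝ) 1,
      HasDerivAt (fun s => y s x) (yt t x) t)
    (hyx : ∀ t ∈ Set.Icc (0:ℝ) T, ∀ x ∈ Set.Icc (0:ℝ) 1,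
      HasDerivAt (fun ξ => y t ξ) (yx t x) x)
    (hytx : ∀ t ∈ Set.Icc (0:ℝ) T, ∀ x ∈ Set.Icc (0:ℝ) 1,
      HasDerivAt (fun ξ => yt t ξ) (ytx t x) x)
    (cyt : ∀ x ∈ Set.Icc (0:ℝ) 1, ContinuousOn (fun t => yt t x) (Set.Icc 0 T))
    (cytx : ∀ x ∈ Set.Icc (0:ℝ) 1, ContinuousOn (fun t => ytx t x) (Set.Icc 0 T))
    {C : ℝ} (hC : ∀ t ∈ Set.Icc (0:ℝ) T, ∀ x ∈ Set.Icc (0:ℝ) 1, |ytx t x| ≤ C)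
    {x t : ℝ} (hx : x ∈ Set.Ioo (0:ℝ) 1) (ht : t ∈ Set.Ioo (0:ℝ) T) :
    HasDerivAt (fun τ => yx τ x) (ytx t x) t := by
  have hxc := Set.Ioo_subset_Icc_self hx
  have hint : ∀ τ ∈ Set.Icc (0:ℝ) T, ∀ f : ℝ → ℝ, ContinuousOn f (Set.Icc 0 T) →
      IntervalIntegrable f volume 0 τ := fun τ hτ f hf =>
    (hf.mono (Set.Icc_subset_Icc_right hτ.2)).intervalIntegrable_of_Icc hτ.1
  have hsub : ∀ τ ∈ Set.Icc (0:ℝ) T, Set.uIoc 0 τ ⊆ Set.Icc 0 T := by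
    intro τ hτ
    rw [Set.uIoc_of_le hτ.1]
    exact Set.Ioc_subset_Icc_self.trans (Set.Icc_subset_Icc_right hτ.2)
  have key : ∀ τ ∈ Set.Icc (0:ℝ) T, yx τ x = yx 0 x + ∫ r in (0:ℝ)..τ, ytx r x := by
    intro τ hτ
    have h0 : (0:ℝ) ∈ Set.Icc 0 T := ⟨le_rfl, hτ.1.trans hτ.2⟩
    have hN : Set.Ioo (0:ℝ) 1 ∈ nhds x := Ioo_mem_nhds hx.1 hx.2
    have h1 := (intervalIntegral.hasDerivAt_integral_of_dominated_loc_of_deriv_le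
      (μ := volume) (a := 0) (b := τ) (F := fun ξ r => yt r ξ) (F' := fun ξ r => ytx r ξ)
      (bound := fun _ => C) hN
      (by
        filter_upwards [hN] with ξ hξ
        exact (hint τ hτ _ (cyt ξ (Set.Ioo_subset_Icc_self hξ))).def'.aestronglyMeasurable)
      (hint τ hτ _ (cyt x hxc))
      (hint τ hτ _ (cytx x hxc)).def'.aestronglyMeasurable
      (.of_forall fun r hr ξ hξ => hC r (hsub τ hτ hr) ξ (Set.Ioo_subset_Icc_self hξ))
      (by simp)
      (.of_forall fun r hr ξ hξ => hytx r (hsub τ hτ hr) ξ (Set.Ioo_subset_Icc_self hξ))).2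
    have h2 : HasDerivAt (fun ξ => y τ ξ - y 0 ξ) (yx τ x - yx 0 x) x :=
      (hyx τ hτ x hxc).fun_sub (hyx 0 h0 x hxc)
    have h3 : (fun ξ => y τ ξ - y 0 ξ) =ᶠ[nhds x] fun ξ => ∫ r in (0:ℝ)..τ, yt r ξ := by
      filter_upwards [hN] with ξ hξ
      have hξ := Set.Ioo_subset_Icc_self hξ
      refine (integral_eq_sub_of_hasDerivAt (f := fun r => y r ξ) (fun r hr => ?_)
        (hint τ hτ _ (cyt ξ hξ))).symm
      rw [Set.uIcc_of_le hτ.1] at hr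
      exact hyt r ⟨hr.1, hr.2.trans hτ.2⟩ ξ hξ
    linarith [h2.unique (h1.congr_of_eventuallyEq h3)]
  have hN : Set.Icc (0:ℝ) T ∈ nhds t := Icc_mem_nhds ht.1 ht.2
  have htc := Set.Ioo_subset_Icc_self ht
  have h4 : HasDerivAt (fun τ => ∫ r in (0:ℝ)..τ, ytx r x) (ytx t x) t :=
    integral_hasDerivAt_right (hint t htc _ (cytx x hxc))
      (((cytx x hxc).mono Set.Ioo_subset_Icc_self).stronglyMeasurableAtFilter isOpen_Ioo t ht)
      ((cytx x hxc).continuousAt hN)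
  refine (h4.const_add (yx 0 x)).congr_of_eventuallyEq ?_
  filter_upwards [hN] with τ hτ using key τ hτ

lemma integral_mul_deriv_mul_fourth_deriv {p q r z : ℝ → ℝ}
    (hp : ∀ x ∈ Set.Icc (0:ℝ) 1, HasDerivAt p (q x) x)
    (hq : ∀ x ∈ Set.Icc (0:ℝ) 1, HasDerivAt q (r x) x)
    (hr : ∀ x ∈ Set.Icc (0:ℝ) 1, HasDerivAt r (z x) x)
    (hz : ContinuousOn z (Set.Icc 0 1)) (hp0 : p 0 = 0) :
    (∫ x in (0:ℝ)..1, x * p x * z x) =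
      p 1 * r 1 - p 1 * q 1 - q 1 ^ 2 / 2 + 3 / 2 * ∫ x in (0:ℝ)..1, q x ^ 2 := by
  have cp : ContinuousOn p (Set.Icc 0 1) := HasDerivAt.continuousOn hp
  have cq : ContinuousOn q (Set.Icc 0 1) := HasDerivAt.continuousOn hq
  have i1 : IntervalIntegrable (fun x => x * p x * z x) volume 0 1 :=
    ((continuousOn_id.mul cp).mul hz).intervalIntegrable_of_Icc zero_le_one
  have i2 : IntervalIntegrable (fun x => 3 / 2 * q x ^ 2) volume 0 1 :=
    (continuousOn_const.mul (cq.pow 2)).intervalIntegrable_of_Icc zero_le_one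
  have hF := integral_eq_sub_of_hasDerivAt (a := 0) (b := 1)
    (f := fun x => x * p x * r x - p x * q x - x * q x ^ 2 / 2)
    (f' := fun x => x * p x * z x - 3 / 2 * q x ^ 2)
    (fun x hx => by
      rw [Set.uIcc_of_le zero_le_one] at hx
      have h := ((((hasDerivAt_id x).fun_mul (hp x hx)).fun_mul (hr x hx)).fun_sub
        ((hp x hx).fun_mul (hq x hx))).fun_sub
        (((hasDerivAt_id x).fun_mul ((hq x hx).fun_pow 2)).div_const 2)
      refine h.congr_deriv ?_
      simp only [id]
      push_cast
      ring) (i1.sub i2)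
  rw [intervalIntegral.integral_sub i1 i2, intervalIntegral.integral_const_mul] at hF
  simp only [hp0] at hF
  linarith

lemma integral_mul_weight_mul_deriv {a a' w w' : ℝ → ℝ} {C M : ℝ}
    (ha_pos : ∀ x ∈ Set.Ioc (0:ℝ) 1, 0 < a x)
    (ha_deriv : ∀ x ∈ Set.Ioc (0:ℝ) 1, HasDerivAt a (a' x) x)
    (hM : ∀ x ∈ Set.Ioc (0:ℝ) 1, x ^ 2 / a x ≤ M)
    (hw : ∀ x ∈ Set.Icc (0:ℝ) 1, HasDerivAt w (w' x) x)
    (hwC : ∀ x ∈ Set.Icc (0:ℝ) 1, |w x| ≤ C * x)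
    (i1 : IntervalIntegrable (fun x => w x * (x / a x) * w' x) volume 0 1)
    (i2 : IntervalIntegrable (fun x => w x ^ 2 / a x * (1 - x * a' x / a x)) volume 0 1) :
    2 * (∫ x in (0:ℝ)..1, w x * (x / a x) * w' x)
      + (∫ x in (0:ℝ)..1, w x ^ 2 / a x * (1 - x * a' x / a x)) = w 1 ^ 2 / a 1 := by
  have hd : ∀ x ∈ Set.Ioc (0:ℝ) 1, HasDerivAt (fun x => x / a x * w x ^ 2)
      (2 * (w x * (x / a x) * w' x) + w x ^ 2 / a x * (1 - x * a' x / a x)) x := by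
    intro x hx
    have h0 := (ha_pos x hx).ne'
    refine (((hasDerivAt_id x).fun_div (ha_deriv x hx) h0).fun_mul
      ((hw x (Set.Ioc_subset_Icc_self hx)).fun_pow 2)).congr_deriv ?_
    simp only [id]
    push_cast
    field_simp
    ring
  have hc : ContinuousOn (fun x => x / a x * w x ^ 2) (Set.Icc 0 1) := by
    intro x hx
    rcases hx.1.eq_or_lt with rfl | h0
    · have hlim : Filter.Tendsto (fun x : ℝ => C ^ 2 * M * x) (nhdsWithin 0 (Set.Icc 0 1))
          (nhds 0) := by
        have : Continuous fun x : ℝ => C ^ 2 * M * x := by fun_prop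
        simpa using this.continuousWithinAt (s := Set.Icc (0:ℝ) 1) (x := 0) |>.tendsto
      rw [ContinuousWithinAt]
      simp only [zero_div, zero_mul]
      refine squeeze_zero_norm' ?_ hlim
      filter_upwards [self_mem_nhdsWithin] with z hz
      rcases hz.1.eq_or_lt with rfl | hz0
      · simp
      · have haz := ha_pos z ⟨hz0, hz.2⟩
        have hwz : w z ^ 2 ≤ (C * z) ^ 2 := sq_le_sq' (abs_le.1 (hwC z hz)).1 (abs_le.1 (hwC z hz)).2
        rw [Real.norm_of_nonneg (by positivity)]
        calc z / a z * w z ^ 2 ≤ z / a z * (C * z) ^ 2 := by gcongr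
          _ = C ^ 2 * (z ^ 2 / a z) * z := by ring
          _ ≤ C ^ 2 * M * z := by gcongr; exact hM z ⟨hz0, hz.2⟩
    · exact (hd x ⟨h0, hx.2⟩).continuousAt.continuousWithinAt
  have hF := integral_eq_sub_of_hasDerivAt_of_le zero_le_one hc
    (fun x hx => hd x (Set.Ioo_subset_Ioc_self hx)) ((i1.const_mul 2).add i2)
  rw [intervalIntegral.integral_add (i1.const_mul 2) i2,
    intervalIntegral.integral_const_mul] at hF
  rw [hF]
  ring

/-- Proposition 3.4, identity (3.1): the multiplier identity obtained by multiplying the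
degenerate beam equation by `(x/a) ∂_x y` and integrating over `(s,T) × (0,1)`. -/
theorem stmt13
    (T β γ K : ℝ) (a a' : ℝ → ℝ)
    (y yt ytt yx yxx yxxx yxxxx ytx ytxx : ℝ → ℝ → ℝ)
    (hT : 0 < T) (hβ : 0 ≤ β) (hγ : 0 ≤ γ)
    -- degeneracy context
    (ha_cont : ContinuousOn a (Set.Icc 0 1))
    (ha0 : a 0 = 0)
    (ha_pos : ∀ x ∈ Set.Ioc (0:ℝ) 1, 0 < a x)
    (ha_deriv : ∀ x ∈ Set.Ioc (0:ℝ) 1, HasDerivAt a (a' x) x)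
    (ha'_cont : ContinuousOn a' (Set.Ioc 0 1))
    (hK0 : 0 < K) (hK2 : K < 2)
    (hKbound : ∀ x ∈ Set.Ioc (0:ℝ) 1, x * |a' x| ≤ K * a x)
    -- smoothness: all the relevant partial derivatives exist ...
    (hyt : ∀ t ∈ Set.Icc (0:ℝ) T, ∀ x ∈ Set.Icc (0:ℝ) 1,
      HasDerivAt (fun s => y s x) (yt t x) t)
    (hytt : ∀ t ∈ Set.Icc (0:ℝ) T, ∀ x ∈ Set.Icc (0:ℝ) 1,
      HasDerivAt (fun s => yt s x) (ytt t x) t)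
    (hyx : ∀ t ∈ Set.Icc (0:ℝ) T, ∀ x ∈ Set.Icc (0:ℝ) 1,
      HasDerivAt (fun ξ => y t ξ) (yx t x) x)
    (hyxx : ∀ t ∈ Set.Icc (0:ℝ) T, ∀ x ∈ Set.Icc (0:ℝ) 1,
      HasDerivAt (fun ξ => yx t ξ) (yxx t x) x)
    (hyxxx : ∀ t ∈ Set.Icc (0:ℝ) T, ∀ x ∈ Set.Icc (0:ℝ) 1,
      HasDerivAt (fun ξ => yxx t ξ) (yxxx t x) x)
    (hyxxxx : ∀ t ∈ Set.Icc (0:ℝ) T, ∀ x ∈ Set.Icc (0:ℝ) 1,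
      HasDerivAt (fun ξ => yxxx t ξ) (yxxxx t x) x)
    (hytx : ∀ t ∈ Set.Icc (0:ℝ) T, ∀ x ∈ Set.Icc (0:ℝ) 1,
      HasDerivAt (fun ξ => yt t ξ) (ytx t x) x)
    (hytxx : ∀ t ∈ Set.Icc (0:ℝ) T, ∀ x ∈ Set.Icc (0:ℝ) 1,
      HasDerivAt (fun ξ => ytx t ξ) (ytxx t x) x)
    -- ... and are continuous on the space-time domain
    (hcont : ∀ f ∈ [y, yt, ytt, yx, yxx, yxxx, yxxxx, ytx, ytxx],
      ContinuousOn (fun p : ℝ × ℝ => f p.1 p.2) (Set.Icc (0:ℝ) T ×ˢ Set.Icc 0 1))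
    -- the degenerate beam equation
    (heq : ∀ t ∈ Set.Icc (0:ℝ) T, ∀ x ∈ Set.Ioc (0:ℝ) 1,
      ytt t x + a x * yxxxx t x = 0)
    -- clamped conditions at 0, dissipative conditions at 1
    (hbc0 : ∀ t ∈ Set.Icc (0:ℝ) T, y t 0 = 0 ∧ yx t 0 = 0)
    (hbc1 : ∀ t ∈ Set.Icc (0:ℝ) T,
      β * y t 1 - yxxx t 1 + yt t 1 = 0 ∧ γ * yx t 1 + yxx t 1 + ytx t 1 = 0) :
    ∀ s : ℝ, 0 < s → s < T →
      0 = 2 * (∫ x in (0:ℝ)..1,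
            (yt T x * (x / a x) * yx T x - yt s x * (x / a x) * yx s x))
        - (1 / a 1) * (∫ t in s..T, (yt t 1) ^ 2)
        + (∫ t in s..T, ∫ x in (0:ℝ)..1,
            ((yt t x) ^ 2 / a x) * (1 - x * a' x / a x))
        + 3 * (∫ t in s..T, ∫ x in (0:ℝ)..1, (yxx t x) ^ 2)
        + 2 * β * (∫ t in s..T, yx t 1 * y t 1)
        + 2 * (∫ t in s..T, yx t 1 * yt t 1)
        + 2 * γ * (∫ t in s..T, (yx t 1) ^ 2)
        + 2 * (∫ t in s..T, yx t 1 * ytx t 1)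
        - (∫ t in s..T, (yxx t 1) ^ 2) := by
  intro s hs0 hsT
  have mem1 : (1:ℝ) ∈ Set.Icc (0:ℝ) 1 := Set.right_mem_Icc.2 zero_le_one
  have mem0 : (0:ℝ) ∈ Set.Icc (0:ℝ) 1 := Set.left_mem_Icc.2 zero_le_one
  have hsub : Set.Icc s T ⊆ Set.Icc 0 T := Set.Icc_subset_Icc_left hs0.le
  have hIoc : Set.Ioc (0:ℝ) 1 ⊆ Set.Icc 0 1 := Set.Ioc_subset_Icc_self
  -- continuity on the closed rectangle, bounds, and continuity of slices
  have cy := hcont y (by simp)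
  have cyt := hcont yt (by simp)
  have cytt := hcont ytt (by simp)
  have cyx := hcont yx (by simp)
  have cyxx := hcont yxx (by simp)
  have cyxxxx := hcont yxxxx (by simp)
  have cytx := hcont ytx (by simp)
  have bdd : ∀ f : ℝ → ℝ → ℝ,
      ContinuousOn (fun p : ℝ × ℝ => f p.1 p.2) (Set.Icc (0:ℝ) T ×ˢ Set.Icc 0 1) →
      ∃ C, ∀ t ∈ Set.Icc (0:ℝ) T, ∀ x ∈ Set.Icc (0:ℝ) 1, |f t x| ≤ C := fun f hf =>
    let ⟨C, hC⟩ := (isCompact_Icc.prod isCompact_Icc).exists_bound_of_continuousOn hf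
    ⟨C, fun t ht x hx => hC (t, x) ⟨ht, hx⟩⟩
  have slice_t : ∀ f : ℝ → ℝ → ℝ,
      ContinuousOn (fun p : ℝ × ℝ => f p.1 p.2) (Set.Icc (0:ℝ) T ×ˢ Set.Icc 0 1) →
      ∀ x ∈ Set.Icc (0:ℝ) 1, ContinuousOn (fun t => f t x) (Set.Icc 0 T) := fun f hf x hx =>
    hf.comp (f := fun t => (t, x)) (by fun_prop) fun t ht => ⟨ht, hx⟩
  have slice_x : ∀ f : ℝ → ℝ → ℝ,
      ContinuousOn (fun p : ℝ × ℝ => f p.1 p.2) (Set.Icc s T ×ˢ Set.Ioc 0 1) →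
      ∀ t ∈ Set.Icc s T, ContinuousOn (fun x => f t x) (Set.Ioc 0 1) := fun f hf t ht =>
    hf.comp (f := fun x => (t, x)) (by fun_prop) fun x hx => ⟨ht, hx⟩
  obtain ⟨Ctt, hCtt⟩ := bdd ytt cytt
  obtain ⟨Cxx, hCxx⟩ := bdd yxx cyxx
  obtain ⟨Ctx, hCtx⟩ := bdd ytx cytx
  have hM : ∀ x ∈ Set.Ioc (0:ℝ) 1, x ^ 2 / a x ≤ 1 / a 1 := fun x hx =>
    sq_div_le_of_degeneracy hK2.le ha_pos ha_deriv hKbound hx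
  have hyt0 : ∀ t ∈ Set.Icc (0:ℝ) T, yt t 0 = 0 := by
    intro t ht
    refine (uniqueDiffOn_Icc hT t ht).eq_deriv _ (hyt t ht 0 mem0).hasDerivWithinAt ?_
    exact (hasDerivWithinAt_const t _ (0:ℝ)).congr (fun r hr => (hbc0 r hr).1) (hbc0 t ht).1
  have lin : ∀ (f f' : ℝ → ℝ) (C : ℝ), (∀ x ∈ Set.Icc (0:ℝ) 1, HasDerivAt f (f' x) x) →
      (∀ x ∈ Set.Icc (0:ℝ) 1, |f' x| ≤ C) → f 0 = 0 →
      ∀ x ∈ Set.Icc (0:ℝ) 1, |f x| ≤ C * x := by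
    intro f f' C hf hC h0 x hx
    have := (convex_Icc (0:ℝ) 1).norm_image_sub_le_of_norm_hasDerivWithin_le
      (fun z hz => (hf z hz).hasDerivWithinAt) hC mem0 hx
    simpa [h0, abs_of_nonneg hx.1] using this
  have hyx_lin : ∀ t ∈ Set.Icc (0:ℝ) T, ∀ x ∈ Set.Icc (0:ℝ) 1, |yx t x| ≤ Cxx * x :=
    fun t ht => lin _ _ _ (hyxx t ht) (hCxx t ht) (hbc0 t ht).2
  have hyt_lin : ∀ t ∈ Set.Icc (0:ℝ) T, ∀ x ∈ Set.Icc (0:ℝ) 1, |yt t x| ≤ Ctx * x :=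
    fun t ht => lin _ _ _ (hytx t ht) (hCtx t ht) (hyt0 t ht)
  -- the integrands on the half-open rectangle
  have hrect : Set.Icc s T ×ˢ Set.Ioc (0:ℝ) 1 ⊆ Set.Icc 0 T ×ˢ Set.Icc 0 1 :=
    Set.prod_mono hsub hIoc
  have csnd : ContinuousOn (fun p : ℝ × ℝ => p.2) (Set.Icc s T ×ˢ Set.Ioc 0 1) :=
    continuousOn_snd
  have ca : ContinuousOn (fun p : ℝ × ℝ => a p.2) (Set.Icc s T ×ˢ Set.Ioc 0 1) :=
    (ha_cont.mono hIoc).comp csnd fun p hp => hp.2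
  have ca' : ContinuousOn (fun p : ℝ × ℝ => a' p.2) (Set.Icc s T ×ˢ Set.Ioc 0 1) :=
    ha'_cont.comp csnd fun p hp => hp.2
  have hane : ∀ p ∈ Set.Icc s T ×ˢ Set.Ioc (0:ℝ) 1, a p.2 ≠ 0 := fun p hp =>
    (ha_pos _ hp.2).ne'
  have cA : ContinuousOn (fun p : ℝ × ℝ => ytt p.1 p.2 * (p.2 / a p.2) * yx p.1 p.2)
      (Set.Icc s T ×ˢ Set.Ioc 0 1) :=
    ((cytt.mono hrect).mul (csnd.div ca hane)).mul (cyx.mono hrect)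
  have cB : ContinuousOn (fun p : ℝ × ℝ => yt p.1 p.2 * (p.2 / a p.2) * ytx p.1 p.2)
      (Set.Icc s T ×ˢ Set.Ioc 0 1) :=
    ((cyt.mono hrect).mul (csnd.div ca hane)).mul (cytx.mono hrect)
  have cD : ContinuousOn
      (fun p : ℝ × ℝ => yt p.1 p.2 ^ 2 / a p.2 * (1 - p.2 * a' p.2 / a p.2))
      (Set.Icc s T ×ˢ Set.Ioc 0 1) :=
    (((cyt.mono hrect).pow 2).div ca hane).mul
      (continuousOn_const.sub ((csnd.mul ca').div ca hane))
  have cE : ContinuousOn (fun p : ℝ × ℝ => yxx p.1 p.2 ^ 2) (Set.Icc s T ×ˢ Set.Ioc 0 1) :=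
    (cyxx.mono hrect).pow 2
  have bA : ∀ t ∈ Set.Icc s T, ∀ x ∈ Set.Ioc (0:ℝ) 1,
      |ytt t x * (x / a x) * yx t x| ≤ Cxx * (1 / a 1) * Ctt := by
    intro t ht x hx
    rw [show ytt t x * (x / a x) * yx t x = yx t x * (x / a x) * ytt t x by ring]
    exact abs_mul_div_mul_le hx.1 (ha_pos x hx) (hM x hx) rfl
      (hyx_lin t (hsub ht) x (hIoc hx)) (hCtt t (hsub ht) x (hIoc hx))
  have bB : ∀ t ∈ Set.Icc s T, ∀ x ∈ Set.Ioc (0:ℝ) 1,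
      |yt t x * (x / a x) * ytx t x| ≤ Ctx * (1 / a 1) * Ctx := by
    intro t ht x hx
    exact abs_mul_div_mul_le hx.1 (ha_pos x hx) (hM x hx) rfl
      (hyt_lin t (hsub ht) x (hIoc hx)) (hCtx t (hsub ht) x (hIoc hx))
  have bD : ∀ t ∈ Set.Icc s T, ∀ x ∈ Set.Ioc (0:ℝ) 1,
      |yt t x ^ 2 / a x * (1 - x * a' x / a x)| ≤ Ctx ^ 2 * (1 / a 1) * (1 + K) := by
    intro t ht x hx
    have hax := ha_pos x hx
    have ha1 := ha_pos 1 ⟨zero_lt_one, le_rfl⟩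
    have h1 := hyt_lin t (hsub ht) x (hIoc hx)
    have h2 : yt t x ^ 2 / a x ≤ Ctx ^ 2 * (1 / a 1) :=
      calc yt t x ^ 2 / a x ≤ (Ctx * x) ^ 2 / a x :=
            div_le_div_of_nonneg_right (sq_le_sq' (abs_le.1 h1).1 (abs_le.1 h1).2) hax.le
        _ = Ctx ^ 2 * (x ^ 2 / a x) := by ring
        _ ≤ Ctx ^ 2 * (1 / a 1) := mul_le_mul_of_nonneg_left (hM x hx) (sq_nonneg _)
    have h3 : |1 - x * a' x / a x| ≤ 1 + K := by
      refine (abs_sub _ _).trans ?_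
      rw [abs_one, abs_div, abs_mul, abs_of_pos hx.1, abs_of_pos hax]
      gcongr
      exact (div_le_iff₀ hax).2 (hKbound x hx)
    rw [abs_mul, abs_of_nonneg (by positivity : 0 ≤ yt t x ^ 2 / a x)]
    gcongr
  have bE : ∀ t ∈ Set.Icc s T, ∀ x ∈ Set.Ioc (0:ℝ) 1, |yxx t x ^ 2| ≤ Cxx ^ 2 := by
    intro t ht x hx
    rw [abs_pow]
    gcongr
    exact hCxx t (hsub ht) x (hIoc hx)
  have iAB : IntegrableOn (Function.uncurry fun t x => ytt t x * (x / a x) * yx t x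
      + yt t x * (x / a x) * ytx t x) (Set.Ioc s T ×ˢ Set.Ioc 0 1) :=
    (integrableOn_prod_of_continuousOn_of_bounded cA bA).add
      (integrableOn_prod_of_continuousOn_of_bounded cB bB)
  have iD := integrableOn_prod_of_continuousOn_of_bounded cD bD
  have iE := integrableOn_prod_of_continuousOn_of_bounded cE bE
  -- integration in space at a fixed time
  have space : ∀ t ∈ Set.Icc s T,
      2 * (∫ x in (0:ℝ)..1, (ytt t x * (x / a x) * yx t x + yt t x * (x / a x) * ytx t x))
        - (1 / a 1) * (yt t 1) ^ 2
        + (∫ x in (0:ℝ)..1, ((yt t x) ^ 2 / a x) * (1 - x * a' x / a x))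
        + 3 * (∫ x in (0:ℝ)..1, (yxx t x) ^ 2)
        + 2 * β * (yx t 1 * y t 1) + 2 * (yx t 1 * yt t 1) + 2 * γ * (yx t 1) ^ 2
        + 2 * (yx t 1 * ytx t 1) - (yxx t 1) ^ 2 = 0 := by
    intro t ht
    have ht0 := hsub ht
    have jA := intervalIntegrable_of_continuousOn_Ioc_of_bounded
      (slice_x (fun t x => ytt t x * (x / a x) * yx t x) cA t ht) (bA t ht)
    have jB := intervalIntegrable_of_continuousOn_Ioc_of_bounded
      (slice_x (fun t x => yt t x * (x / a x) * ytx t x) cB t ht) (bB t ht)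
    have jD := intervalIntegrable_of_continuousOn_Ioc_of_bounded
      (slice_x (fun t x => yt t x ^ 2 / a x * (1 - x * a' x / a x)) cD t ht) (bD t ht)
    have hA : (∫ x in (0:ℝ)..1, ytt t x * (x / a x) * yx t x)
        = -∫ x in (0:ℝ)..1, x * yx t x * yxxxx t x := by
      rw [← intervalIntegral.integral_neg]
      refine integral_congr_Ioo_of_le zero_le_one fun x hx => ?_
      have hx := Set.Ioo_subset_Ioc_self hx
      have h0 := (ha_pos x hx).ne'
      have h1 : ytt t x = -(a x * yxxxx t x) := by linarith [heq t ht0 x hx]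
      simp only [h1]
      field_simp
    have czx : ContinuousOn (fun x => yxxxx t x) (Set.Icc 0 1) :=
      cyxxxx.comp (f := fun x => (t, x)) (by fun_prop) fun x hx => ⟨ht0, hx⟩
    have h4 := integral_mul_deriv_mul_fourth_deriv (hyxx t ht0) (hyxxx t ht0) (hyxxxx t ht0)
      czx (hbc0 t ht0).2
    have hB := integral_mul_weight_mul_deriv ha_pos ha_deriv hM (hytx t ht0)
      (hyt_lin t ht0) jB jD
    rw [intervalIntegral.integral_add jA jB, hA, h4]
    have e1 : yxxx t 1 = β * y t 1 + yt t 1 := by linarith [(hbc1 t ht0).1]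
    have e2 : ytx t 1 = -(γ * yx t 1) - yxx t 1 := by linarith [(hbc1 t ht0).2]
    rw [div_eq_mul_one_div] at hB
    rw [e1, e2]
    linear_combination hB
  -- integration in time
  have time : (∫ t in s..T, ∫ x in (0:ℝ)..1,
        (ytt t x * (x / a x) * yx t x + yt t x * (x / a x) * ytx t x))
      = ∫ x in (0:ℝ)..1, (yt T x * (x / a x) * yx T x - yt s x * (x / a x) * yx s x) := by
    rw [intervalIntegral_intervalIntegral_swap
      (by rwa [Set.uIoc_of_le hsT.le, Set.uIoc_of_le zero_le_one])]
    refine integral_congr_Ioo_of_le zero_le_one fun x hx => ?_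
    have hxc := Set.Ioo_subset_Icc_self hx
    have c1 := (slice_t yt cyt x hxc).mono hsub
    have c2 := (slice_t yx cyx x hxc).mono hsub
    have c3 := (slice_t ytt cytt x hxc).mono hsub
    have c4 := (slice_t ytx cytx x hxc).mono hsub
    refine integral_eq_sub_of_hasDerivAt_of_le (f := fun t => yt t x * (x / a x) * yx t x)
      hsT.le ((c1.mul continuousOn_const).mul c2) (fun t ht => ?_)
      ((((c3.mul continuousOn_const).mul c2).add
        ((c1.mul continuousOn_const).mul c4)).intervalIntegrable_of_Icc hsT.le)
    exact ((hytt t (hsub (Set.Ioo_subset_Icc_self ht)) x hxc).mul_const _).fun_mul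
      (hasDerivAt_space_deriv_time hyt hyx hytx (slice_t yt cyt) (slice_t ytx cytx) hCtx hx
        ⟨hs0.trans ht.1, ht.2⟩)
  have b1 := (slice_t y cy 1 mem1).mono hsub
  have b2 := (slice_t yt cyt 1 mem1).mono hsub
  have b3 := (slice_t yx cyx 1 mem1).mono hsub
  have b4 := (slice_t ytx cytx 1 mem1).mono hsub
  have b5 := (slice_t yxx cyxx 1 mem1).mono hsub
  have k1 := (intervalIntegrable_integral_of_integrableOn_prod hsT.le iAB).const_mul 2
  have k2 := ((b2.fun_pow 2).intervalIntegrable_of_Icc (μ := volume) hsT.le).const_mul (1 / a 1)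
  have k3 := intervalIntegrable_integral_of_integrableOn_prod hsT.le iD
  have k4 := (intervalIntegrable_integral_of_integrableOn_prod hsT.le iE).const_mul 3
  have k5 := ((b3.fun_mul b1).intervalIntegrable_of_Icc (μ := volume) hsT.le).const_mul (2 * β)
  have k6 := ((b3.fun_mul b2).intervalIntegrable_of_Icc (μ := volume) hsT.le).const_mul 2
  have k7 := ((b3.fun_pow 2).intervalIntegrable_of_Icc (μ := volume) hsT.le).const_mul (2 * γ)
  have k8 := ((b3.fun_mul b4).intervalIntegrable_of_Icc (μ := volume) hsT.le).const_mul 2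
  have k9 := (b5.fun_pow 2).intervalIntegrable_of_Icc (μ := volume) hsT.le
  have l3 := (k1.sub k2).add k3
  have l4 := l3.add k4
  have l5 := l4.add k5
  have l6 := l5.add k6
  have l7 := l6.add k7
  have l8 := l7.add k8
  have total := integral_congr (μ := volume) (a := s) (b := T) (g := fun _ => (0:ℝ))
    fun t ht => space t (by rwa [Set.uIcc_of_le hsT.le] at ht)
  rw [intervalIntegral.integral_sub l8 k9, intervalIntegral.integral_add l7 k8,
    intervalIntegral.integral_add l6 k7, intervalIntegral.integral_add l5 k6,
    intervalIntegral.integral_add l4 k5, intervalIntegral.integral_add l3 k4,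
    intervalIntegral.integral_add (k1.sub k2) k3, intervalIntegral.integral_sub k1 k2] at total
  simp only [intervalIntegral.integral_const_mul, intervalIntegral.integral_zero, time] at total
  exact total.symm
end

section
/- Let a be as in the degeneracy context with K := sup_{x∈(0,1]} x|a'(x)|/a(x), and let y be a smooth classical solution of the degenerate beam problem on [0,T]×[0,1] with constants β ≥ 0, γ ≥ 0. Then for every 0 < s < T: ∫ₛ^T∫₀¹ ((∂_t y)²/a)·(K/2 + 1 − x a'(x)/a(x)) dx dt + (3 − K/2)∫ₛ^T∫₀¹ (∂_x² y)² dx dt = (K/2)∫₀¹ [y(t,x)·∂_t y(t,x)/a(x)]_{t=s}^{t=T} dx − 2∫₀¹ [∂_t y(t,x)·(x/a(x))·∂_x y(t,x)]_{t=s}^{t=T} dx + (Kβ/2)∫ₛ^T y(t,1)² dt + (K/2)∫ₛ^T y(t,1)·∂_t y(t,1) dt + γ(K/2 − 2)∫ₛ^T (∂_x y(t,1))² dt + (K/2 − 2)∫ₛ^T ∂_x y(t,1)·∂_t∂_x y(t,1) dt + (1/a(1))∫ₛ^T (∂_t y(t,1))² dt − 2β∫ₛ^T ∂_x y(t,1)·y(t,1)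 dt − 2∫ₛ^T ∂_x y(t,1)·∂_t y(t,1) dt + ∫ₛ^T (∂_x² y(t,1))² dt. -/
open MeasureTheory intervalIntegral

/-- A function continuous on a compact rectangle agrees there with a continuous function on the
plane. -/
lemma exists_continuous_eq_on_rectangle {f : ℝ → ℝ → ℝ} {a b c d : ℝ} (hab : a ≤ b) (hcd : c ≤ d)
    (hf : ContinuousOn (fun p : ℝ × ℝ => f p.1 p.2) (Set.Icc a b ×ˢ Set.Icc c d)) :
    ∃ g : ℝ → ℝ → ℝ, Continuous (Function.uncurry g) ∧
      ∀ t ∈ Set.Icc a b, ∀ x ∈ Set.Icc c d, g t x = f t x := by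
  refine ⟨fun t x => f (Set.projIcc a b hab t) (Set.projIcc c d hcd x), ?_, ?_⟩
  · exact hf.comp_continuous
      (f := fun p : ℝ × ℝ => ((Set.projIcc a b hab p.1 : ℝ), (Set.projIcc c d hcd p.2 : ℝ)))
      (by fun_prop) (fun p => ⟨Subtype.prop _, Subtype.prop _⟩)
  · intro t ht x hx
    simp only [Set.projIcc_of_mem hab ht, Set.projIcc_of_mem hcd hx]

lemma continuousOn_slice_left {f : ℝ → ℝ → ℝ} {S U : Set ℝ}
    (hf : ContinuousOn (fun p : ℝ × ℝ => f p.1 p.2) (S ×ˢ U)) {x : ℝ} (hx : x ∈ U) :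
    ContinuousOn (fun t => f t x) S :=
  hf.comp (f := fun t => (t, x)) (by fun_prop) (fun _ ht => ⟨ht, hx⟩)

lemma continuousOn_slice_right {f : ℝ → ℝ → ℝ} {S U : Set ℝ}
    (hf : ContinuousOn (fun p : ℝ × ℝ => f p.1 p.2) (S ×ˢ U)) {t : ℝ} (ht : t ∈ S) :
    ContinuousOn (fun x => f t x) U :=
  hf.comp (f := fun x => (t, x)) (by fun_prop) (fun _ hx => ⟨ht, hx⟩)

lemma continuousOn_integral_slice {f : ℝ → ℝ → ℝ} {a b c d : ℝ} (hab : a ≤ b) (hcd : c ≤ d)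
    (hf : ContinuousOn (fun p : ℝ × ℝ => f p.1 p.2) (Set.Icc a b ×ˢ Set.Icc c d)) :
    ContinuousOn (fun t => ∫ x in c..d, f t x) (Set.Icc a b) := by
  obtain ⟨g, hg, hgf⟩ := exists_continuous_eq_on_rectangle hab hcd hf
  have h := continuous_parametric_intervalIntegral_of_continuous' (μ := volume) hg c d
  refine h.continuousOn.congr fun t ht => integral_congr fun x hx => ?_
  rw [Set.uIcc_of_le hcd] at hx
  exact (hgf t ht x hx).symm

lemma integral_swap_of_continuousOn {f : ℝ → ℝ → ℝ} {a b c d : ℝ} (hab : a ≤ b) (hcd : c ≤ d)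
    (hf : ContinuousOn (fun p : ℝ × ℝ => f p.1 p.2) (Set.Icc a b ×ˢ Set.Icc c d)) :
    ∫ t in a..b, ∫ x in c..d, f t x = ∫ x in c..d, ∫ t in a..b, f t x := by
  refine intervalIntegral_intervalIntegral_swap ?_
  rw [Set.uIoc_of_le hab, Set.uIoc_of_le hcd]
  exact (hf.integrableOn_compact (isCompact_Icc.prod isCompact_Icc)).mono_set
    (Set.prod_mono Set.Ioc_subset_Icc_self Set.Ioc_subset_Icc_self)

/-- Symmetry of mixed partial derivatives: if `∂_x ∂_t u` is continuous, then it is also the time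
derivative of `∂_x u`. -/
lemma hasDerivAt_mixed {T : ℝ} {u ut ux utx : ℝ → ℝ → ℝ} (hT : 0 < T)
    (hut : ∀ t ∈ Set.Icc (0:ℝ) T, ∀ x ∈ Set.Icc (0:ℝ) 1, HasDerivAt (fun s => u s x) (ut t x) t)
    (hux : ∀ t ∈ Set.Icc (0:ℝ) T, ∀ x ∈ Set.Icc (0:ℝ) 1, HasDerivAt (fun ξ => u t ξ) (ux t x) x)
    (hutx : ∀ t ∈ Set.Icc (0:ℝ) T, ∀ x ∈ Set.Icc (0:ℝ) 1,
      HasDerivAt (fun ξ => ut t ξ) (utx t x) x)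
    (cut : ContinuousOn (fun p : ℝ × ℝ => ut p.1 p.2) (Set.Icc (0:ℝ) T ×ˢ Set.Icc 0 1))
    (cux : ContinuousOn (fun p : ℝ × ℝ => ux p.1 p.2) (Set.Icc (0:ℝ) T ×ˢ Set.Icc 0 1))
    (cutx : ContinuousOn (fun p : ℝ × ℝ => utx p.1 p.2) (Set.Icc (0:ℝ) T ×ˢ Set.Icc 0 1))
    {t x : ℝ} (ht : t ∈ Set.Ioo 0 T) (hx : x ∈ Set.Icc (0:ℝ) 1) :
    HasDerivAt (fun s => ux s x) (utx t x) t := by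
  obtain ⟨v, hv, hvu⟩ := exists_continuous_eq_on_rectangle hT.le zero_le_one cutx
  have h0 : (0:ℝ) ∈ Set.Icc 0 T := ⟨le_rfl, hT.le⟩
  have h00 : (0:ℝ) ∈ Set.Icc (0:ℝ) 1 := ⟨le_rfl, zero_le_one⟩
  have hvx (ξ : ℝ) : Continuous fun τ => v τ ξ := hv.comp (Continuous.prodMk_left ξ)
  have hvt (τ : ℝ) : Continuous fun ξ => v τ ξ := hv.comp (Continuous.prodMk_right τ)
  have key (r : ℝ) (hr : r ∈ Set.Icc 0 T) (ξ : ℝ) (hξ : ξ ∈ Set.Icc (0:ℝ) 1) :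
      ux r ξ - ux 0 ξ = ∫ τ in (0:ℝ)..r, v τ ξ := by
    have cD : Continuous fun ξ => ∫ τ in (0:ℝ)..r, v τ ξ :=
      continuous_parametric_intervalIntegral_of_continuous' (μ := volume)
        (f := fun ξ τ => v τ ξ) (hv.comp continuous_swap) 0 r
    have prim (z : ℝ) (hz : z ∈ Set.Icc (0:ℝ) 1) :
        (u r z - u 0 z) - (u r 0 - u 0 0) = ∫ η in (0:ℝ)..z, ∫ τ in (0:ℝ)..r, v τ η := by
      have inner (τ : ℝ) (hτ : τ ∈ Set.Icc 0 T) :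
          ∫ η in (0:ℝ)..z, v τ η = ut τ z - ut τ 0 := by
        refine integral_eq_sub_of_hasDerivAt (fun η hη => ?_) ((hvt τ).intervalIntegrable _ _)
        rw [Set.uIcc_of_le hz.1] at hη
        have hη' : η ∈ Set.Icc (0:ℝ) 1 := ⟨hη.1, hη.2.trans hz.2⟩
        rw [hvu τ hτ η hη']
        exact hutx τ hτ η hη'
      have outer (w : ℝ) (hw : w ∈ Set.Icc (0:ℝ) 1) :
          ∫ τ in (0:ℝ)..r, ut τ w = u r w - u 0 w := by
        have hsub : Set.Icc 0 r ⊆ Set.Icc 0 T := Set.Icc_subset_Icc_right hr.2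
        refine integral_eq_sub_of_hasDerivAt (f := fun τ => u τ w) (fun τ hτ => ?_)
          (((continuousOn_slice_left cut hw).mono hsub).intervalIntegrable_of_Icc hr.1)
        rw [Set.uIcc_of_le hr.1] at hτ
        exact hut τ (hsub hτ) w hw
      have hsub : Set.Icc 0 r ⊆ Set.Icc 0 T := Set.Icc_subset_Icc_right hr.2
      rw [← integral_swap_of_continuousOn (f := v) hr.1 hz.1 hv.continuousOn, ← outer z hz,
        ← outer 0 h00, ← intervalIntegral.integral_sub
          (((continuousOn_slice_left cut hz).mono hsub).intervalIntegrable_of_Icc hr.1)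
          (((continuousOn_slice_left cut h00).mono hsub).intervalIntegrable_of_Icc hr.1)]
      refine integral_congr fun τ hτ => ?_
      rw [Set.uIcc_of_le hr.1] at hτ
      exact (inner τ (hsub hτ)).symm
    have hIoo : Set.EqOn (fun ξ => ux r ξ - ux 0 ξ) (fun ξ => ∫ τ in (0:ℝ)..r, v τ ξ)
        (Set.Ioo 0 1) := by
      intro z hz
      have hz' := Set.Ioo_subset_Icc_self hz
      have d1 : HasDerivAt (fun z => (u r z - u 0 z) - (u r 0 - u 0 0)) (ux r z - ux 0 z) z :=
        ((hux r hr z hz').sub (hux 0 h0 z hz')).sub_const _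
      have d2 := integral_hasDerivAt_right (cD.intervalIntegrable 0 z)
        (cD.stronglyMeasurableAtFilter _ _) cD.continuousAt
      refine d1.unique (d2.congr_of_eventuallyEq ?_)
      filter_upwards [Icc_mem_nhds hz.1 hz.2] with η hη using prim η hη
    refine Set.EqOn.of_subset_closure hIoo ?_ cD.continuousOn Set.Ioo_subset_Icc_self
      (closure_Ioo zero_ne_one).ge hξ
    exact (continuousOn_slice_right cux hr).sub (continuousOn_slice_right cux h0)
  have d := (integral_hasDerivAt_right ((hvx x).intervalIntegrable 0 t)
    ((hvx x).stronglyMeasurableAtFilter _ _) (hvx x).continuousAt).const_add (ux 0 x)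
  rw [hvu t (Set.Ioo_subset_Icc_self ht) x hx] at d
  refine d.congr_of_eventuallyEq ?_
  filter_upwards [Icc_mem_nhds ht.1 ht.2] with r hr
  rw [← key r hr x hx]
  ring

lemma deriv_eq_zero_of_eq_zero_on_Icc {T : ℝ} {f f' : ℝ → ℝ} (hT : 0 < T)
    (hf : ∀ t ∈ Set.Icc 0 T, f t = 0) (hd : ∀ t ∈ Set.Ioo 0 T, HasDerivAt f (f' t) t)
    (hc : ContinuousOn f' (Set.Icc 0 T)) : ∀ t ∈ Set.Icc 0 T, f' t = 0 := by
  have h : Set.EqOn f' (fun _ => 0) (Set.Ioo 0 T) := by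
    intro t ht
    refine (hd t ht).unique ((hasDerivAt_const t (0:ℝ)).congr_of_eventuallyEq ?_)
    filter_upwards [Icc_mem_nhds ht.1 ht.2] with r hr using hf r hr
  exact fun t ht => h.of_subset_closure hc continuousOn_const Set.Ioo_subset_Icc_self
    (closure_Ioo hT.ne).ge ht

lemma abs_le_mul_pow_succ_of_deriv {f f' : ℝ → ℝ} {C : ℝ} (n : ℕ) (hC : 0 ≤ C) (hf0 : f 0 = 0)
    (hd : ∀ x ∈ Set.Icc (0:ℝ) 1, HasDerivAt f (f' x) x)
    (hb : ∀ x ∈ Set.Icc (0:ℝ) 1, |f' x| ≤ C * x ^ n) :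
    ∀ x ∈ Set.Icc (0:ℝ) 1, |f x| ≤ C * x ^ (n + 1) := by
  intro x hx
  have h := norm_image_sub_le_of_norm_deriv_le_segment' (f := f) (f' := f') (a := 0) (b := x)
    (C := C * x ^ n) (fun z hz => (hd z ⟨hz.1, hz.2.trans hx.2⟩).hasDerivWithinAt)
    (fun z hz => (hb z ⟨hz.1, hz.2.le.trans hx.2⟩).trans
      (mul_le_mul_of_nonneg_left (pow_le_pow_left₀ hz.1 hz.2.le n) hC)) x ⟨hx.1, le_rfl⟩
  rw [hf0, sub_zero, sub_zero, Real.norm_eq_abs] at h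
  rw [pow_succ, ← mul_assoc]
  exact h

/-- A function vanishing to second order at `x = 0`, uniformly in time, is quadratically small. -/
lemma exists_quadratic_bound {T : ℝ} {u ux uxx : ℝ → ℝ → ℝ}
    (hux : ∀ t ∈ Set.Icc (0:ℝ) T, ∀ x ∈ Set.Icc (0:ℝ) 1, HasDerivAt (fun ξ => u t ξ) (ux t x) x)
    (huxx : ∀ t ∈ Set.Icc (0:ℝ) T, ∀ x ∈ Set.Icc (0:ℝ) 1,
      HasDerivAt (fun ξ => ux t ξ) (uxx t x) x)
    (cuxx : ContinuousOn (fun p : ℝ × ℝ => uxx p.1 p.2) (Set.Icc (0:ℝ) T ×ˢ Set.Icc 0 1))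
    (h0 : ∀ t ∈ Set.Icc (0:ℝ) T, u t 0 = 0) (h1 : ∀ t ∈ Set.Icc (0:ℝ) T, ux t 0 = 0) :
    ∃ C, 0 ≤ C ∧ ∀ t ∈ Set.Icc (0:ℝ) T, ∀ x ∈ Set.Icc (0:ℝ) 1,
      |u t x| ≤ C * x ^ 2 ∧ |ux t x| ≤ C * x := by
  obtain ⟨C, hC⟩ := (isCompact_Icc.prod isCompact_Icc).exists_bound_of_continuousOn cuxx
  refine ⟨max C 0, le_max_right _ _, fun t ht x hx => ?_⟩
  have b1 := abs_le_mul_pow_succ_of_deriv (f := fun ξ => ux t ξ) (f' := fun ξ => uxx t ξ) 0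
    (le_max_right C 0) (h1 t ht) (huxx t ht)
    (fun z hz => by simpa using Or.inl (hC (t, z) ⟨ht, hz⟩))
  have b2 := abs_le_mul_pow_succ_of_deriv (f := fun ξ => u t ξ) (f' := fun ξ => ux t ξ) 1
    (le_max_right C 0) (h0 t ht) (hux t ht) b1
  exact ⟨b2 x hx, by simpa using b1 x hx⟩

/-- Multiplication by a weight with a singularity of order at most two at `x = 0` preserves
continuity of functions vanishing to third order there. -/
lemma continuousOn_mul_weight {S : Set ℝ} {f : ℝ → ℝ → ℝ} {w : ℝ → ℝ} {C M : ℝ} (hC : 0 ≤ C)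
    (hf : ContinuousOn (fun p : ℝ × ℝ => f p.1 p.2) (S ×ˢ Set.Icc 0 1))
    (hw : ContinuousOn w (Set.Ioc 0 1)) (hwM : ∀ x ∈ Set.Ioc (0:ℝ) 1, x ^ 2 * |w x| ≤ M)
    (hfC : ∀ t ∈ S, ∀ x ∈ Set.Icc (0:ℝ) 1, |f t x| ≤ C * x ^ 3) :
    ContinuousOn (fun p : ℝ × ℝ => f p.1 p.2 * w p.2) (S ×ˢ Set.Icc 0 1) := by
  rintro ⟨t, x⟩ ⟨ht, hx⟩
  rcases hx.1.eq_or_lt with rfl | hx0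
  · have hf0 (τ : ℝ) (hτ : τ ∈ S) : f τ 0 = 0 := by
      simpa using hfC τ hτ 0 ⟨le_rfl, zero_le_one⟩
    have hlim : Filter.Tendsto (fun p : ℝ × ℝ => C * M * p.2)
        (nhdsWithin (t, 0) (S ×ˢ Set.Icc 0 1)) (nhds 0) := by
      have : Continuous fun p : ℝ × ℝ => C * M * p.2 := by fun_prop
      simpa using (this.tendsto (t, 0)).mono_left nhdsWithin_le_nhds
    simp only [ContinuousWithinAt, hf0 t ht, zero_mul]
    refine squeeze_zero_norm' ?_ hlim
    filter_upwards [self_mem_nhdsWithin] with p hp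
    obtain ⟨hp1, hp2⟩ := hp
    rcases hp2.1.eq_or_lt with h | h
    · simp [← h, hf0 _ hp1]
    · rw [Real.norm_eq_abs, abs_mul]
      calc |f p.1 p.2| * |w p.2| ≤ C * p.2 ^ 3 * |w p.2| :=
            mul_le_mul_of_nonneg_right (hfC _ hp1 _ hp2) (abs_nonneg _)
        _ = C * p.2 * (p.2 ^ 2 * |w p.2|) := by ring
        _ ≤ C * p.2 * M :=
            mul_le_mul_of_nonneg_left (hwM _ ⟨h, hp2.2⟩) (mul_nonneg hC h.le)
        _ = C * M * p.2 := by ring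
  · have hwx : ContinuousWithinAt w (Set.Icc 0 1) x :=
      (hw x ⟨hx0, hx.2⟩).mono_of_mem_nhdsWithin <| by
        filter_upwards [self_mem_nhdsWithin, nhdsWithin_le_nhds (Ioi_mem_nhds hx0)] with z hz hz'
        exact ⟨hz', hz.2⟩
    exact (hf (t, x) ⟨ht, hx⟩).mul
      (hwx.comp (t := Set.Icc 0 1) (f := fun p : ℝ × ℝ => p.2) continuous_snd.continuousWithinAt
        (fun p hp => hp.2))

lemma sq_div_le_of_degenerate {K : ℝ} {a a' : ℝ → ℝ}
    (ha_pos : ∀ x ∈ Set.Ioc (0:ℝ) 1, 0 < a x)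
    (ha_deriv : ∀ x ∈ Set.Ioc (0:ℝ) 1, HasDerivAt a (a' x) x) (hK2 : K < 2)
    (hKbound : ∀ x ∈ Set.Ioc (0:ℝ) 1, x * |a' x| ≤ K * a x) :
    ∀ x ∈ Set.Ioc (0:ℝ) 1, x ^ 2 / a x ≤ 1 / a 1 := by
  have hd (x : ℝ) (hx : x ∈ Set.Ioc (0:ℝ) 1) :
      HasDerivAt (fun x => x ^ 2 / a x) ((2 * x * a x - x ^ 2 * a' x) / a x ^ 2) x := by
    refine ((hasDerivAt_pow 2 x).div (ha_deriv x hx) (ha_pos x hx).ne').congr_deriv ?_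
    norm_num
  have hmono : MonotoneOn (fun x => x ^ 2 / a x) (Set.Ioc 0 1) := by
    refine monotoneOn_of_hasDerivWithinAt_nonneg (convex_Ioc 0 1)
      (fun x hx => (hd x hx).continuousAt.continuousWithinAt)
      (fun x hx => (hd x (interior_subset hx)).hasDerivWithinAt) (fun x hx => ?_)
    have hx' := interior_subset hx
    have h1 := hKbound x hx'
    have h2 : x * a' x ≤ x * |a' x| := mul_le_mul_of_nonneg_left (le_abs_self _) hx'.1.le
    have h3 : 0 ≤ x * (2 * a x - x * a' x) :=
      mul_nonneg hx'.1.le (by nlinarith [ha_pos x hx'])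
    exact div_nonneg (by linarith) (sq_nonneg _)
  intro x hx
  simpa using hmono hx ⟨zero_lt_one, le_rfl⟩ hx.2

/-- Identity (3.7): sum of identity (3.1) and `K/2` times the identity coming from the
multiplier `y/a`. -/
theorem stmt14
    (T β γ K : ℝ) (a a' : ℝ → ℝ)
    (y yt ytt yx yxx yxxx yxxxx ytx ytxx : ℝ → ℝ → ℝ)
    (hT : 0 < T) (hβ : 0 ≤ β) (hγ : 0 ≤ γ)
    -- degeneracy context
    (ha_cont : ContinuousOn a (Set.Icc 0 1))
    (ha0 : a 0 = 0)
    (ha_pos : ∀ x ∈ Set.Ioc (0:ℝ) 1, 0 < a x)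
    (ha_deriv : ∀ x ∈ Set.Ioc (0:ℝ) 1, HasDerivAt a (a' x) x)
    (ha'_cont : ContinuousOn a' (Set.Ioc 0 1))
    (hK0 : 0 < K) (hK2 : K < 2)
    (hKbound : ∀ x ∈ Set.Ioc (0:ℝ) 1, x * |a' x| ≤ K * a x)
    -- smoothness: all the relevant partial derivatives exist ...
    (hyt : ∀ t ∈ Set.Icc (0:ℝ) T, ∀ x ∈ Set.Icc (0:ℝ) 1,
      HasDerivAt (fun s => y s x) (yt t x) t)
    (hytt : ∀ t ∈ Set.Icc (0:ℝ) T, ∀ x ∈ Set.Icc (0:ℝ) 1,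
      HasDerivAt (fun s => yt s x) (ytt t x) t)
    (hyx : ∀ t ∈ Set.Icc (0:ℝ) T, ∀ x ∈ Set.Icc (0:ℝ) 1,
      HasDerivAt (fun ξ => y t ξ) (yx t x) x)
    (hyxx : ∀ t ∈ Set.Icc (0:ℝ) T, ∀ x ∈ Set.Icc (0:ℝ) 1,
      HasDerivAt (fun ξ => yx t ξ) (yxx t x) x)
    (hyxxx : ∀ t ∈ Set.Icc (0:ℝ) T, ∀ x ∈ Set.Icc (0:ℝ) 1,
      HasDerivAt (fun ξ => yxx t ξ) (yxxx t x) x)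
    (hyxxxx : ∀ t ∈ Set.Icc (0:ℝ) T, ∀ x ∈ Set.Icc (0:ℝ) 1,
      HasDerivAt (fun ξ => yxxx t ξ) (yxxxx t x) x)
    (hytx : ∀ t ∈ Set.Icc (0:ℝ) T, ∀ x ∈ Set.Icc (0:ℝ) 1,
      HasDerivAt (fun ξ => yt t ξ) (ytx t x) x)
    (hytxx : ∀ t ∈ Set.Icc (0:ℝ) T, ∀ x ∈ Set.Icc (0:ℝ) 1,
      HasDerivAt (fun ξ => ytx t ξ) (ytxx t x) x)
    -- ... and are continuous on the space-time domain
    (hcont : ∀ f ∈ [y, yt, ytt, yx, yxx, yxxx, yxxxx, ytx, ytxx],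
      ContinuousOn (fun p : ℝ × ℝ => f p.1 p.2) (Set.Icc (0:ℝ) T ×ˢ Set.Icc 0 1))
    -- the degenerate beam equation
    (heq : ∀ t ∈ Set.Icc (0:ℝ) T, ∀ x ∈ Set.Ioc (0:ℝ) 1,
      ytt t x + a x * yxxxx t x = 0)
    -- clamped conditions at 0, dissipative conditions at 1
    (hbc0 : ∀ t ∈ Set.Icc (0:ℝ) T, y t 0 = 0 ∧ yx t 0 = 0)
    (hbc1 : ∀ t ∈ Set.Icc (0:ℝ) T,
      β * y t 1 - yxxx t 1 + yt t 1 = 0 ∧ γ * yx t 1 + yxx t 1 + ytx t 1 = 0) :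
    ∀ s : ℝ, 0 < s → s < T →
      (∫ t in s..T, ∫ x in (0:ℝ)..1,
          ((yt t x) ^ 2 / a x) * (K/2 + 1 - x * a' x / a x))
        + (3 - K/2) * (∫ t in s..T, ∫ x in (0:ℝ)..1, (yxx t x) ^ 2)
      = (K/2) * (∫ x in (0:ℝ)..1,
            (y T x * yt T x / a x - y s x * yt s x / a x))
        - 2 * (∫ x in (0:ℝ)..1,
            (yt T x * (x / a x) * yx T x - yt s x * (x / a x) * yx s x))
        + (K * β / 2) * (∫ t in s..T, (y t 1) ^ 2)
        + (K/2) * (∫ t in s..T, y t 1 * yt t 1)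
        + γ * (K/2 - 2) * (∫ t in s..T, (yx t 1) ^ 2)
        + (K/2 - 2) * (∫ t in s..T, yx t 1 * ytx t 1)
        + (1 / a 1) * (∫ t in s..T, (yt t 1) ^ 2)
        - 2 * β * (∫ t in s..T, yx t 1 * y t 1)
        - 2 * (∫ t in s..T, yx t 1 * yt t 1)
        + (∫ t in s..T, (yxx t 1) ^ 2) := by
  intro s hs0 hsT
  simp only [List.forall_mem_cons, List.not_mem_nil, false_imp_iff, implies_true,
    and_true] at hcont
  obtain ⟨cy, cyt, cytt, cyx, cyxx, cyxxx, cyxxxx, cytx, cytxx⟩ := hcont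
  have h00 : (0:ℝ) ∈ Set.Icc (0:ℝ) 1 := ⟨le_rfl, zero_le_one⟩
  have h11 : (1:ℝ) ∈ Set.Icc (0:ℝ) 1 := ⟨zero_le_one, le_rfl⟩
  have hsub : Set.Icc s T ⊆ Set.Icc 0 T := Set.Icc_subset_Icc_left hs0.le
  have hyxt (t : ℝ) (ht : t ∈ Set.Ioo 0 T) (x : ℝ) (hx : x ∈ Set.Icc (0:ℝ) 1) :
      HasDerivAt (fun s => yx s x) (ytx t x) t :=
    hasDerivAt_mixed hT hyt hyx hytx cyt cyx cytx ht hx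
  have hyt0 : ∀ t ∈ Set.Icc 0 T, yt t 0 = 0 :=
    deriv_eq_zero_of_eq_zero_on_Icc hT (fun t ht => (hbc0 t ht).1)
      (fun t ht => hyt t (Set.Ioo_subset_Icc_self ht) 0 h00) (continuousOn_slice_left cyt h00)
  have hytx0 : ∀ t ∈ Set.Icc 0 T, ytx t 0 = 0 :=
    deriv_eq_zero_of_eq_zero_on_Icc hT (fun t ht => (hbc0 t ht).2)
      (fun t ht => hyxt t ht 0 h00) (continuousOn_slice_left cytx h00)
  obtain ⟨C, hC, bC⟩ := exists_quadratic_bound hyx hyxx cyxx (fun t ht => (hbc0 t ht).1)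
    (fun t ht => (hbc0 t ht).2)
  obtain ⟨D, hD, bD⟩ := exists_quadratic_bound hytx hytxx cytxx hyt0 hytx0
  have hsq := sq_div_le_of_degenerate ha_pos ha_deriv hK2 hKbound
  set w : ℝ → ℝ := fun x => (a x)⁻¹ with hw
  set w' : ℝ → ℝ := fun x => x * a' x / a x ^ 2 with hw'
  have cw : ContinuousOn w (Set.Ioc 0 1) :=
    (ha_cont.mono Set.Ioc_subset_Icc_self).inv₀ fun x hx => (ha_pos x hx).ne'
  have cw' : ContinuousOn w' (Set.Ioc 0 1) :=
    (continuousOn_id.mul ha'_cont).div ((ha_cont.mono Set.Ioc_subset_Icc_self).pow 2)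
      fun x hx => pow_ne_zero 2 (ha_pos x hx).ne'
  have bw (x : ℝ) (hx : x ∈ Set.Ioc (0:ℝ) 1) : x ^ 2 * |w x| ≤ 1 / a 1 := by
    rw [hw, abs_of_pos (inv_pos.2 (ha_pos x hx)), ← div_eq_mul_inv]
    exact hsq x hx
  have bw' (x : ℝ) (hx : x ∈ Set.Ioc (0:ℝ) 1) : x ^ 2 * |w' x| ≤ K * (1 / a 1) := by
    have hax := ha_pos x hx
    calc x ^ 2 * |w' x| = x ^ 2 / a x * (x * |a' x| / a x) := by
          rw [hw', abs_div, abs_mul, abs_of_pos hx.1, abs_of_pos (pow_pos hax 2)]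
          field_simp
      _ ≤ x ^ 2 / a x * K :=
          mul_le_mul_of_nonneg_left ((div_le_iff₀ hax).2 (hKbound x hx)) (by positivity)
      _ ≤ 1 / a 1 * K := mul_le_mul_of_nonneg_right (hsq x hx) hK0.le
      _ = K * (1 / a 1) := mul_comm _ _
  have pow43 (x : ℝ) (hx : x ∈ Set.Icc (0:ℝ) 1) : x ^ 4 ≤ x ^ 3 :=
    pow_le_pow_of_le_one hx.1 hx.2 (by norm_num)
  have btt (t : ℝ) (ht : t ∈ Set.Icc 0 T) (x : ℝ) (hx : x ∈ Set.Icc (0:ℝ) 1) :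
      |yt t x ^ 2| ≤ D * D * x ^ 3 := by
    have hx0 := hx.1
    rw [abs_pow, pow_two]
    calc |yt t x| * |yt t x| ≤ (D * x ^ 2) * (D * x ^ 2) :=
          mul_le_mul (bD t ht x hx).1 (bD t ht x hx).1 (abs_nonneg _) (by positivity)
      _ = D * D * x ^ 4 := by ring
      _ ≤ D * D * x ^ 3 := mul_le_mul_of_nonneg_left (pow43 x hx) (by positivity)
  have byt (t : ℝ) (ht : t ∈ Set.Icc 0 T) (x : ℝ) (hx : x ∈ Set.Icc (0:ℝ) 1) :
      |y t x * yt t x| ≤ C * D * x ^ 3 := by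
    have hx0 := hx.1
    rw [abs_mul]
    calc |y t x| * |yt t x| ≤ (C * x ^ 2) * (D * x ^ 2) :=
          mul_le_mul (bC t ht x hx).1 (bD t ht x hx).1 (abs_nonneg _) (by positivity)
      _ = C * D * x ^ 4 := by ring
      _ ≤ C * D * x ^ 3 := mul_le_mul_of_nonneg_left (pow43 x hx) (by positivity)
  have bx (E : ℝ) (hE : 0 ≤ E) (v : ℝ → ℝ → ℝ) (t : ℝ) (ht : t ∈ Set.Icc 0 T) (x : ℝ)
      (hx : x ∈ Set.Icc (0:ℝ) 1) (hv : |v t x| ≤ E * x) :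
      |x * yt t x * v t x| ≤ D * E * x ^ 3 := by
    have hx0 := hx.1
    rw [abs_mul, abs_mul, abs_of_nonneg hx0]
    calc x * |yt t x| * |v t x| ≤ (x * (D * x ^ 2)) * (E * x) :=
          mul_le_mul (mul_le_mul_of_nonneg_left (bD t ht x hx).1 hx0) hv (abs_nonneg _)
            (by positivity)
      _ = D * E * x ^ 4 := by ring
      _ ≤ D * E * x ^ 3 := mul_le_mul_of_nonneg_left (pow43 x hx) (by positivity)
  have c1 := continuousOn_mul_weight (f := fun t x => yt t x ^ 2) (mul_nonneg hD hD)
    (by fun_prop) cw bw btt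
  have c2 := continuousOn_mul_weight (f := fun t x => yt t x ^ 2) (mul_nonneg hD hD)
    (by fun_prop) cw' bw' btt
  have c3 := continuousOn_mul_weight (f := fun t x => y t x * yt t x) (mul_nonneg hC hD)
    (by fun_prop) cw bw byt
  have c4 := continuousOn_mul_weight (f := fun t x => x * yt t x * yx t x) (mul_nonneg hD hC)
    (by fun_prop) cw bw fun t ht x hx => bx C hC yx t ht x hx (bC t ht x hx).2
  have c5 := continuousOn_mul_weight (f := fun t x => x * yt t x * ytx t x) (mul_nonneg hD hD)
    (by fun_prop) cw bw fun t ht x hx => bx D hD ytx t ht x hx (bD t ht x hx).2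
  set P : ℝ → ℝ → ℝ := fun t x => (K/2 + 1) * (yt t x ^ 2 * w x) - yt t x ^ 2 * w' x with hP
  set G : ℝ → ℝ → ℝ := fun t x => K/2 * (yt t x ^ 2 * w x - y t x * yxxxx t x)
    - 2 * (x * yt t x * ytx t x * w x) + 2 * (x * yx t x * yxxxx t x) with hG
  set g : ℝ → ℝ → ℝ := fun t x => K/2 * (y t x * yt t x * w x) - 2 * (x * yt t x * yx t x * w x)
    with hg
  have cP : ContinuousOn (fun p : ℝ × ℝ => P p.1 p.2) (Set.Icc (0:ℝ) T ×ˢ Set.Icc 0 1) :=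
    (c1.const_mul _).sub c2
  have cG : ContinuousOn (fun p : ℝ × ℝ => G p.1 p.2) (Set.Icc (0:ℝ) T ×ˢ Set.Icc 0 1) :=
    (((c1.sub (cy.mul cyxxxx)).const_mul _).sub (c5.const_mul _)).add
      (((continuousOn_snd.mul cyx).mul cyxxxx).const_mul _)
  have cg : ContinuousOn (fun p : ℝ × ℝ => g p.1 p.2) (Set.Icc (0:ℝ) T ×ˢ Set.Icc 0 1) :=
    (c3.const_mul _).sub (c4.const_mul _)
  have cxx2 : ContinuousOn (fun p : ℝ × ℝ => yxx p.1 p.2 ^ 2) (Set.Icc (0:ℝ) T ×ˢ Set.Icc 0 1) :=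
    cyxx.pow 2
  have space (t : ℝ) (ht : t ∈ Set.Icc 0 T) :
      (∫ x in (0:ℝ)..1, P t x) + (3 - K/2) * (∫ x in (0:ℝ)..1, yxx t x ^ 2)
        - (∫ x in (0:ℝ)..1, G t x)
      = 1 / a 1 * yt t 1 ^ 2 + K/2 * (y t 1 * yxxx t 1 - yx t 1 * yxx t 1)
        - 2 * (yx t 1 * yxxx t 1) + 2 * (yx t 1 * yxx t 1) + yxx t 1 ^ 2 := by
    have iP := (continuousOn_slice_right cP ht).intervalIntegrable_of_Icc (μ := volume) zero_le_one
    have iG := (continuousOn_slice_right cG ht).intervalIntegrable_of_Icc (μ := volume) zero_le_one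
    have iX := (continuousOn_slice_right (f := fun t x => yxx t x ^ 2) cxx2
      ht).intervalIntegrable_of_Icc (μ := volume) zero_le_one
    rw [← intervalIntegral.integral_const_mul, ← intervalIntegral.integral_add iP (iX.const_mul _),
      ← intervalIntegral.integral_sub (iP.add (iX.const_mul _)) iG]
    have sy := continuousOn_slice_right cy ht
    have syx := continuousOn_slice_right cyx ht
    have syxx := continuousOn_slice_right cyxx ht
    have syxxx := continuousOn_slice_right cyxxx ht
    have s1 := continuousOn_slice_right (f := fun t x => yt t x ^ 2 * w x) c1 ht
    have cH : ContinuousOn (fun x => x * (yt t x ^ 2 * w x)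
        + (K/2 * (y t x * yxxx t x - yx t x * yxx t x)
        - 2 * (x * yx t x * yxxx t x) + 2 * (yx t x * yxx t x) + x * yxx t x ^ 2))
        (Set.Icc 0 1) := by fun_prop
    rw [integral_eq_sub_of_hasDerivAt_of_le zero_le_one cH ?_
      ((iP.add (iX.const_mul _)).sub iG)]
    · simp only [(hbc0 t ht).1, (hbc0 t ht).2, hw]
      ring
    · intro x hx
      have hxI := Set.Ioo_subset_Icc_self hx
      have hxo : x ∈ Set.Ioc (0:ℝ) 1 := ⟨hx.1, hx.2.le⟩
      have ha := (ha_pos x hxo).ne'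
      have dw : HasDerivAt w (-a' x / a x ^ 2) x := (ha_deriv x hxo).inv ha
      have d0 := hyx t ht x hxI
      have d1 := hyxx t ht x hxI
      have d2 := hyxxx t ht x hxI
      have d3 := hyxxxx t ht x hxI
      have dt := hytx t ht x hxI
      have did := hasDerivAt_id' x
      have dH := (did.mul ((dt.pow 2).mul dw)).add
        ((((((d0.mul d3).sub (d1.mul d2)).const_mul (K/2)).sub
          (((did.mul d1).mul d3).const_mul 2)).add ((d1.mul d2).const_mul 2)).add
          (did.mul (d2.pow 2)))
      refine dH.congr_deriv ?_
      simp only [hP, hG, hw, hw', Pi.mul_apply, Pi.pow_apply]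
      field_simp
      ring
  have time (x : ℝ) (hx : x ∈ Set.Icc (0:ℝ) 1) : ∫ t in s..T, G t x = g T x - g s x := by
    refine integral_eq_sub_of_hasDerivAt_of_le hsT.le ((continuousOn_slice_left cg hx).mono hsub)
      (fun t ht => ?_) (((continuousOn_slice_left cG hx).mono hsub).intervalIntegrable_of_Icc
        hsT.le)
    have ht' : t ∈ Set.Ioo 0 T := ⟨hs0.trans ht.1, ht.2⟩
    have htI := Set.Ioo_subset_Icc_self ht'
    have d0 := hyt t htI x hx
    have d1 := hytt t htI x hx
    have dx := hyxt t ht' x hx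
    have dg := (((d0.mul d1).mul_const (w x)).const_mul (K/2)).sub
      ((((d1.const_mul x).mul dx).mul_const (w x)).const_mul 2)
    refine dg.congr_deriv ?_
    rcases hx.1.eq_or_lt with rfl | hx0
    · simp [hG, hw, ha0, (hbc0 t htI).1]
    · have hxo : x ∈ Set.Ioc (0:ℝ) 1 := ⟨hx0, hx.2⟩
      have ha := (ha_pos x hxo).ne'
      have e : ytt t x = -(a x * yxxxx t x) := by linarith [heq t htI x hxo]
      simp only [hG, hw, e]
      field_simp
      ring
  have hrect : Set.Icc s T ×ˢ Set.Icc (0:ℝ) 1 ⊆ Set.Icc 0 T ×ˢ Set.Icc (0:ℝ) 1 :=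
    Set.prod_mono hsub subset_rfl
  have swap : ∫ t in s..T, ∫ x in (0:ℝ)..1, G t x
      = ∫ x in (0:ℝ)..1, (g T x - g s x) := by
    rw [integral_swap_of_continuousOn hsT.le zero_le_one (cG.mono hrect)]
    refine integral_congr fun x hx => ?_
    rw [Set.uIcc_of_le zero_le_one] at hx
    exact time x hx
  have hTI : T ∈ Set.Icc 0 T := ⟨hT.le, le_rfl⟩
  have hsI : s ∈ Set.Icc 0 T := ⟨hs0.le, hsT.le⟩
  have split : ∫ x in (0:ℝ)..1, (g T x - g s x)
      = K/2 * (∫ x in (0:ℝ)..1, (y T x * yt T x / a x - y s x * yt s x / a x))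
        - 2 * (∫ x in (0:ℝ)..1,
            (yt T x * (x / a x) * yx T x - yt s x * (x / a x) * yx s x)) := by
    have i3 (t : ℝ) (ht : t ∈ Set.Icc 0 T) := (continuousOn_slice_right
      (f := fun t x => y t x * yt t x * w x) c3 ht).intervalIntegrable_of_Icc (μ := volume)
      zero_le_one
    have i4 (t : ℝ) (ht : t ∈ Set.Icc 0 T) := (continuousOn_slice_right
      (f := fun t x => x * yt t x * yx t x * w x) c4 ht).intervalIntegrable_of_Icc (μ := volume)
      zero_le_one
    have e3 : ∫ x in (0:ℝ)..1, (y T x * yt T x / a x - y s x * yt s x / a x)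
        = ∫ x in (0:ℝ)..1, (y T x * yt T x * w x - y s x * yt s x * w x) := by
      simp only [hw, div_eq_mul_inv]
    have e4 : ∫ x in (0:ℝ)..1, (yt T x * (x / a x) * yx T x - yt s x * (x / a x) * yx s x)
        = ∫ x in (0:ℝ)..1, (x * yt T x * yx T x * w x - x * yt s x * yx s x * w x) := by
      refine integral_congr fun x _ => ?_
      simp only [hw, div_eq_mul_inv]
      ring
    rw [e3, e4, ← intervalIntegral.integral_const_mul, ← intervalIntegral.integral_const_mul,
      ← intervalIntegral.integral_sub (((i3 T hTI).sub (i3 s hsI)).const_mul _)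
        (((i4 T hTI).sub (i4 s hsI)).const_mul _)]
    refine integral_congr fun x _ => ?_
    simp only [hg]
    ring
  have jP := (continuousOn_integral_slice hsT.le zero_le_one
    (cP.mono hrect)).intervalIntegrable_of_Icc (μ := volume) hsT.le
  have jX := (continuousOn_integral_slice (f := fun t x => yxx t x ^ 2) hsT.le zero_le_one
    (cxx2.mono hrect)).intervalIntegrable_of_Icc (μ := volume) hsT.le
  have jG := (continuousOn_integral_slice hsT.le zero_le_one
    (cG.mono hrect)).intervalIntegrable_of_Icc (μ := volume) hsT.le
  have lhs : (∫ t in s..T, ∫ x in (0:ℝ)..1,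
      ((yt t x) ^ 2 / a x) * (K/2 + 1 - x * a' x / a x))
      = ∫ t in s..T, ∫ x in (0:ℝ)..1, P t x := by
    refine integral_congr fun t _ => integral_congr fun x _ => ?_
    simp only [hP, hw, hw', div_eq_mul_inv]
    ring
  have total : (∫ t in s..T, ∫ x in (0:ℝ)..1, P t x)
        + (3 - K/2) * (∫ t in s..T, ∫ x in (0:ℝ)..1, (yxx t x) ^ 2)
        - ∫ t in s..T, ∫ x in (0:ℝ)..1, G t x
      = ∫ t in s..T, (K * β / 2 * y t 1 ^ 2 + K/2 * (y t 1 * yt t 1)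
        + γ * (K/2 - 2) * yx t 1 ^ 2 + (K/2 - 2) * (yx t 1 * ytx t 1)
        + 1 / a 1 * yt t 1 ^ 2 + -2 * β * (yx t 1 * y t 1) + -2 * (yx t 1 * yt t 1)
        + yxx t 1 ^ 2) := by
    rw [← intervalIntegral.integral_const_mul, ← intervalIntegral.integral_add jP (jX.const_mul _),
      ← intervalIntegral.integral_sub (jP.add (jX.const_mul _)) jG]
    refine integral_congr fun t ht => ?_
    rw [Set.uIcc_of_le hsT.le] at ht
    have e3 : yxxx t 1 = β * y t 1 + yt t 1 := by linarith [(hbc1 t (hsub ht)).1]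
    have e2 : yxx t 1 = -γ * yx t 1 - ytx t 1 := by linarith [(hbc1 t (hsub ht)).2]
    have h := space t (hsub ht)
    rw [h, e3]
    linear_combination (2 - K/2) * yx t 1 * e2
  have b0 := (continuousOn_slice_left cy h11).mono hsub
  have b1 := (continuousOn_slice_left cyt h11).mono hsub
  have b2 := (continuousOn_slice_left cyx h11).mono hsub
  have b3 := (continuousOn_slice_left cytx h11).mono hsub
  have b4 := (continuousOn_slice_left cyxx h11).mono hsub
  rw [intervalIntegral.integral_add, intervalIntegral.integral_add, intervalIntegral.integral_add,
    intervalIntegral.integral_add, intervalIntegral.integral_add, intervalIntegral.integral_add,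
    intervalIntegral.integral_add] at total
  · simp only [intervalIntegral.integral_const_mul] at total
    rw [lhs]
    linarith
  all_goals exact ContinuousOn.intervalIntegrable_of_Icc hsT.le (by fun_prop)
end

section
/- Let a be as in the degeneracy context with K := sup_{x∈(0,1]} x|a'(x)|/a(x) < 2, let C_HP > 0 satisfy the weighted Hardy inequality, let β ≥ 0, γ ≥ 0, and let y be a smooth classical solution of the degenerate beam problem on [0,T]×[0,1] with energy E(t). Set θ := max{4/a(1) + K·C_HP, 1 + K/4}, ρ := max{2, K/4 + 1 + 1/a(1)}, and C_γ := min{2, 2/γ} if γ > 0, C_γ := 2 if γ = 0. Then for every ε₀ ∈ (0, 2−K] and every 0 < s < T: (ε₀/2)∫ₛ^T∫₀¹ ((∂_t y)²/a + (∂_x² y)²) dx dt ≤ (4θ + ρ + (C_γ/2)(2 − K/2))·E(s) + (Kβ/2 + K/4 + β)∫ₛ^T y(t,1)² dt + (β + 1 + 2γ²)∫ₛ^T (∂_x y(t,1))² dt. -/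
open MeasureTheory intervalIntegral

open Set in
theorem continuousOn_intervalIntegral_of_continuousOn_rect {f : ℝ → ℝ → ℝ} {a b c d : ℝ}
    (hab : a ≤ b) (hcd : c ≤ d)
    (hf : ContinuousOn (fun p : ℝ × ℝ => f p.1 p.2) (Icc a b ×ˢ Icc c d)) :
    ContinuousOn (fun t => ∫ x in c..d, f t x) (Icc a b) := by
  have hg : Continuous (Function.uncurry fun t x : ℝ =>
      f (projIcc a b hab t : ℝ) (projIcc c d hcd x : ℝ)) := by
    refine hf.comp_continuous (f := fun p : ℝ × ℝ =>
      ((projIcc a b hab p.1 : ℝ), (projIcc c d hcd p.2 : ℝ))) ?_ ?_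
    · exact ((continuous_subtype_val.comp continuous_projIcc).comp continuous_fst).prodMk
        ((continuous_subtype_val.comp continuous_projIcc).comp continuous_snd)
    · exact fun p => ⟨Subtype.coe_prop _, Subtype.coe_prop _⟩
  refine (continuous_parametric_intervalIntegral_of_continuous' (μ := volume)
    hg c d).continuousOn.congr ?_
  intro t ht
  refine integral_congr fun x hx => ?_
  rw [uIcc_of_le hcd] at hx
  simp only [projIcc_of_mem hab ht, projIcc_of_mem hcd hx]

open Set in
theorem intervalIntegral_swap_of_continuousOn_rect {f : ℝ → ℝ → ℝ} {a b c d : ℝ}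
    (hab : a ≤ b) (hcd : c ≤ d)
    (hf : ContinuousOn (fun p : ℝ × ℝ => f p.1 p.2) (Icc a b ×ˢ Icc c d)) :
    ∫ t in a..b, ∫ x in c..d, f t x = ∫ x in c..d, ∫ t in a..b, f t x := by
  refine intervalIntegral_intervalIntegral_swap ?_
  rw [uIoc_of_le hab, uIoc_of_le hcd]
  exact (hf.integrableOn_compact (isCompact_Icc.prod isCompact_Icc)).mono_set
    (prod_mono Ioc_subset_Icc_self Ioc_subset_Icc_self)

open Set in
theorem ContinuousOn.section_fst {f : ℝ → ℝ → ℝ} {A B : Set ℝ}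
    (hf : ContinuousOn (fun p : ℝ × ℝ => f p.1 p.2) (A ×ˢ B)) {x : ℝ} (hx : x ∈ B) :
    ContinuousOn (fun t => f t x) A :=
  hf.comp (f := fun t => (t, x)) (by fun_prop) fun _ ht => ⟨ht, hx⟩

open Set in
theorem ContinuousOn.section_snd {f : ℝ → ℝ → ℝ} {A B : Set ℝ}
    (hf : ContinuousOn (fun p : ℝ × ℝ => f p.1 p.2) (A ×ˢ B)) {t : ℝ} (ht : t ∈ A) :
    ContinuousOn (fun x => f t x) B :=
  hf.comp (f := fun x => (t, x)) (by fun_prop) fun _ hx => ⟨ht, hx⟩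

open Set in
/-- Leibniz rule in integrated form. -/
theorem integral_sub_integral_eq_integral_deriv {F F' : ℝ → ℝ → ℝ} {a b c d : ℝ}
    (hab : a ≤ b) (hcd : c ≤ d)
    (hF : ∀ t ∈ Icc a b, ContinuousOn (F t) (Icc c d))
    (hF' : ContinuousOn (fun p : ℝ × ℝ => F' p.1 p.2) (Icc a b ×ˢ Icc c d))
    (hderiv : ∀ x ∈ Ioc c d, ∀ t ∈ Icc a b,
      HasDerivWithinAt (fun s => F s x) (F' t x) (Icc a b) t) :
    (∫ x in c..d, F b x) - ∫ x in c..d, F a x = ∫ t in a..b, ∫ x in c..d, F' t x := by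
  rw [intervalIntegral_swap_of_continuousOn_rect hab hcd hF', ← intervalIntegral.integral_sub]
  · rw [integral_of_le hcd, integral_of_le hcd]
    refine setIntegral_congr_fun measurableSet_Ioc fun x hx => ?_
    refine (integral_eq_sub_of_hasDerivAt_of_le hab
      (fun t ht => (hderiv x hx t ht).continuousWithinAt)
      (fun t ht => (hderiv x hx t (Ioo_subset_Icc_self ht)).hasDerivAt
        (Icc_mem_nhds ht.1 ht.2)) ?_).symm
    exact (hF'.section_fst (Ioc_subset_Icc_self hx)).intervalIntegrable_of_Icc hab
  · exact (hF b ⟨hab, le_rfl⟩).intervalIntegrable_of_Icc hcd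
  · exact (hF a ⟨le_rfl, hab⟩).intervalIntegrable_of_Icc hcd

open Set in
/-- Symmetry of mixed partial derivatives on a rectangle: if `F` has partial derivatives `Fx`, `Ft`
and `Ft` has the continuous partial derivative `Ftx`, then `Ftx` is the time derivative of `Fx`. -/
theorem hasDerivWithinAt_mixed_partial {F Fx Ft Ftx : ℝ → ℝ → ℝ} {a b c d : ℝ} (hcd : c < d)
    (hFx : ∀ t ∈ Icc a b, ∀ x ∈ Icc c d, HasDerivAt (fun ξ => F t ξ) (Fx t x) x)
    (hFt : ∀ x ∈ Icc c d, ∀ t ∈ Icc a b,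
      HasDerivWithinAt (fun s => F s x) (Ft t x) (Icc a b) t)
    (hFtx : ∀ t ∈ Icc a b, ∀ x ∈ Icc c d, HasDerivAt (fun ξ => Ft t ξ) (Ftx t x) x)
    (cFt : ContinuousOn (fun p : ℝ × ℝ => Ft p.1 p.2) (Icc a b ×ˢ Icc c d))
    (cFtx : ContinuousOn (fun p : ℝ × ℝ => Ftx p.1 p.2) (Icc a b ×ˢ Icc c d)) :
    ∀ x ∈ Icc c d, ∀ t ∈ Icc a b,
      HasDerivWithinAt (fun s => Fx s x) (Ftx t x) (Icc a b) t := by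
  have key : ∀ t ∈ Icc a b, ∀ x ∈ Icc c d, Fx t x = Fx a x + ∫ τ in a..t, Ftx τ x := by
    intro t ht
    have ha : a ∈ Icc a b := ⟨le_rfl, ht.1.trans ht.2⟩
    have hsub : Icc a t ⊆ Icc a b := Icc_subset_Icc_right ht.2
    have cH : ContinuousOn (fun x => ∫ τ in a..t, Ftx τ x) (Icc c d) := by
      refine continuousOn_intervalIntegral_of_continuousOn_rect (f := fun x τ => Ftx τ x)
        hcd.le ht.1 ?_
      exact cFtx.comp (f := fun p : ℝ × ℝ => (p.2, p.1)) (by fun_prop)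
        fun p hp => ⟨hsub hp.2, hp.1⟩
    have hprim : ∀ u ∈ Icc c d, ∫ x in c..u, ∫ τ in a..t, Ftx τ x
        = (F t u - F a u) - (F t c - F a c) := by
      intro u hu
      have hc : c ∈ Icc c d := ⟨le_rfl, hcd.le⟩
      have hsub' : Icc c u ⊆ Icc c d := Icc_subset_Icc_right hu.2
      rw [← intervalIntegral_swap_of_continuousOn_rect ht.1 hu.1
        (cFtx.mono (prod_mono hsub hsub'))]
      have e1 : ∀ x ∈ Icc c d, ∫ τ in a..t, Ft τ x = F t x - F a x := fun x hx =>
        integral_eq_sub_of_hasDerivAt_of_le ht.1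
          (fun τ hτ => (hFt x hx τ (hsub hτ)).continuousWithinAt.mono hsub)
          (fun τ hτ => (hFt x hx τ (hsub (Ioo_subset_Icc_self hτ))).hasDerivAt
            (Icc_mem_nhds hτ.1 (hτ.2.trans_le ht.2)))
          (((cFt.section_fst hx).mono hsub).intervalIntegrable_of_Icc ht.1)
      rw [← e1 u hu, ← e1 c hc, ← intervalIntegral.integral_sub
        (((cFt.section_fst hu).mono hsub).intervalIntegrable_of_Icc ht.1)
        (((cFt.section_fst hc).mono hsub).intervalIntegrable_of_Icc ht.1)]
      refine integral_congr fun τ hτ => ?_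
      rw [uIcc_of_le ht.1] at hτ
      exact integral_eq_sub_of_hasDerivAt
        (fun x hx => hFtx τ (hsub hτ) x (hsub' (by rwa [uIcc_of_le hu.1] at hx)))
        (((cFtx.section_snd (hsub hτ)).mono hsub').intervalIntegrable_of_Icc hu.1)
    intro x hx
    have : Fact (x ∈ Icc c d) := ⟨hx⟩
    have d1 : HasDerivWithinAt (fun u => ∫ x in c..u, ∫ τ in a..t, Ftx τ x)
        (∫ τ in a..t, Ftx τ x) (Icc c d) x :=
      integral_hasDerivWithinAt_right
        ((cH.mono (Icc_subset_Icc_right hx.2)).intervalIntegrable_of_Icc hx.1)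
        (cH.stronglyMeasurableAtFilter_nhdsWithin measurableSet_Icc x) (cH x hx)
    have d2 : HasDerivWithinAt (fun u => (F t u - F a u) - (F t c - F a c))
        (Fx t x - Fx a x) (Icc c d) x :=
      (((hFx t ht x hx).sub (hFx a ha x hx)).sub_const _).hasDerivWithinAt
    have := (uniqueDiffOn_Icc hcd x hx).eq_deriv _ (d1.congr (fun u hu => (hprim u hu).symm)
      (hprim x hx).symm) d2
    linarith
  intro x hx t ht
  have : Fact (t ∈ Icc a b) := ⟨ht⟩
  have c1 := cFtx.section_fst hx
  have d1 : HasDerivWithinAt (fun u => ∫ τ in a..u, Ftx τ x) (Ftx t x) (Icc a b) t :=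
    integral_hasDerivWithinAt_right
      ((c1.mono (Icc_subset_Icc_right ht.2)).intervalIntegrable_of_Icc ht.1)
      (c1.stronglyMeasurableAtFilter_nhdsWithin measurableSet_Icc t) (c1 t ht)
  exact (d1.const_add (Fx a x)).congr (fun u hu => key u hu x hx) (key t ht x hx)

open Set in
/-- Pointwise Poincaré inequality on `[0, 1]`. -/
theorem sq_le_integral_sq_deriv {v v' : ℝ → ℝ}
    (hv : ∀ x ∈ Icc (0 : ℝ) 1, HasDerivAt v (v' x) x) (cv' : ContinuousOn v' (Icc 0 1))
    (v0 : v 0 = 0) {x : ℝ} (hx : x ∈ Icc (0 : ℝ) 1) :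
    v x ^ 2 ≤ ∫ ξ in (0 : ℝ)..1, v' ξ ^ 2 := by
  have hsub : Icc 0 x ⊆ Icc (0 : ℝ) 1 := Icc_subset_Icc_right hx.2
  have hd : ∀ ξ ∈ Icc (0 : ℝ) 1, HasDerivAt (fun u => 2 * v x * v u - v x ^ 2 * u)
      (2 * v x * v' ξ - v x ^ 2 * 1) ξ := fun ξ hξ =>
    ((hv ξ hξ).const_mul _).sub ((hasDerivAt_id ξ).const_mul _)
  have h1 := sub_le_integral_of_hasDeriv_right_of_le hx.1
    (g := fun u => 2 * v x * v u - v x ^ 2 * u) (φ := fun ξ => v' ξ ^ 2)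
    (fun ξ hξ => (hd ξ (hsub hξ)).continuousAt.continuousWithinAt)
    (fun ξ hξ => (hd ξ (hsub (Ioo_subset_Icc_self hξ))).hasDerivWithinAt)
    (((cv'.pow 2).mono hsub).integrableOn_Icc)
    (fun ξ _ => by nlinarith [sq_nonneg (v' ξ - v x)])
  have h2 : ∫ ξ in (0 : ℝ)..x, v' ξ ^ 2 ≤ ∫ ξ in (0 : ℝ)..1, v' ξ ^ 2 :=
    integral_mono_interval le_rfl hx.1 hx.2 (Filter.Eventually.of_forall fun ξ => sq_nonneg _)
      ((cv'.pow 2).intervalIntegrable_of_Icc zero_le_one)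
  simp only [v0] at h1
  nlinarith [mul_nonneg (sq_nonneg (v x)) (sub_nonneg.2 hx.2)]

open Set in
/-- Taylor-type bounds for a function vanishing to second order at `0`. -/
theorem abs_le_of_deriv2_bounded {f f' f'' : ℝ → ℝ} {M : ℝ}
    (hf : ∀ x ∈ Icc (0 : ℝ) 1, HasDerivAt f (f' x) x)
    (hf' : ∀ x ∈ Icc (0 : ℝ) 1, HasDerivAt f' (f'' x) x)
    (f0 : f 0 = 0) (f'0 : f' 0 = 0) (hM : ∀ x ∈ Icc (0 : ℝ) 1, |f'' x| ≤ M)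
    {x : ℝ} (hx : x ∈ Icc (0 : ℝ) 1) : |f' x| ≤ M * x ∧ |f x| ≤ M * x ^ 2 := by
  have h1 : ∀ u ∈ Icc (0 : ℝ) 1, |f' u| ≤ M * u := fun u hu => by
    have := (convex_Icc (0 : ℝ) 1).norm_image_sub_le_of_norm_hasDerivWithin_le
      (fun z hz => (hf' z hz).hasDerivWithinAt) hM ⟨le_rfl, zero_le_one⟩ hu
    simpa [f'0, abs_of_nonneg hu.1] using this
  have hM0 : 0 ≤ M := (abs_nonneg _).trans (hM x hx)
  refine ⟨h1 x hx, ?_⟩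
  have hsub : Icc 0 x ⊆ Icc (0 : ℝ) 1 := Icc_subset_Icc_right hx.2
  have := (convex_Icc (0 : ℝ) x).norm_image_sub_le_of_norm_hasDerivWithin_le (C := M * x)
    (fun z hz => (hf z (hsub hz)).hasDerivWithinAt)
    (fun z hz => (h1 z (hsub hz)).trans (mul_le_mul_of_nonneg_left hz.2 hM0))
    ⟨le_rfl, hx.1⟩ ⟨hx.1, le_rfl⟩
  simpa [f0, abs_of_nonneg hx.1, mul_assoc, ← sq] using this

open Set in
/-- If `x |a'| ≤ 2 a`, then `x ^ 2 / a` is nondecreasing, hence bounded by its value at `1`. -/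
theorem sq_div_le_of_mul_abs_deriv_le {a a' : ℝ → ℝ}
    (ha_pos : ∀ x ∈ Ioc (0 : ℝ) 1, 0 < a x)
    (ha_deriv : ∀ x ∈ Ioc (0 : ℝ) 1, HasDerivAt a (a' x) x)
    (h : ∀ x ∈ Ioc (0 : ℝ) 1, x * |a' x| ≤ 2 * a x) {x : ℝ} (hx : x ∈ Ioc (0 : ℝ) 1) :
    x ^ 2 / a x ≤ 1 / a 1 := by
  have hsub : Icc x 1 ⊆ Ioc (0 : ℝ) 1 := fun u hu => ⟨hx.1.trans_le hu.1, hu.2⟩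
  have hd : ∀ u ∈ Icc x 1, HasDerivAt (fun z => z ^ 2 / a z)
      ((2 * u * a u - u ^ 2 * a' u) / a u ^ 2) u := fun u hu => by
    simpa using (hasDerivAt_pow 2 u).fun_div (ha_deriv u (hsub hu)) (ha_pos u (hsub hu)).ne'
  have hmono : MonotoneOn (fun z => z ^ 2 / a z) (Icc x 1) := by
    refine monotoneOn_of_hasDerivWithinAt_nonneg (convex_Icc x 1)
      (fun u hu => (hd u hu).continuousAt.continuousWithinAt)
      (fun u hu => (hd u (interior_subset hu)).hasDerivWithinAt) fun u hu => ?_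
    have hu' := hsub (interior_subset hu)
    refine div_nonneg ?_ (sq_nonneg _)
    nlinarith [h u hu', mul_le_mul_of_nonneg_left (le_abs_self (a' u)) hu'.1.le, hu'.1]
  simpa using hmono ⟨le_rfl, hx.2⟩ ⟨hx.2, le_rfl⟩ hx.2

open Set in
/-- Dividing by a degenerate coefficient preserves continuity for functions that vanish to high
enough order at the degeneracy point. -/
theorem continuousOn_div_degenerate {a : ℝ → ℝ} {g : ℝ → ℝ → ℝ} {A : Set ℝ} {C D : ℝ}
    (ha_cont : ContinuousOn a (Icc 0 1)) (ha0 : a 0 = 0)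
    (ha_pos : ∀ x ∈ Ioc (0 : ℝ) 1, 0 < a x)
    (ha_sq : ∀ x ∈ Ioc (0 : ℝ) 1, x ^ 2 / a x ≤ D)
    (hg : ContinuousOn (fun p : ℝ × ℝ => g p.1 p.2) (A ×ˢ Icc 0 1))
    (hbound : ∀ t ∈ A, ∀ x ∈ Icc (0 : ℝ) 1, |g t x| ≤ C * x ^ 4) :
    ContinuousOn (fun p : ℝ × ℝ => g p.1 p.2 / a p.2) (A ×ˢ Icc 0 1) := by
  rintro ⟨t, x⟩ ⟨ht, hx⟩
  have hC : 0 ≤ C := by simpa using (abs_nonneg _).trans (hbound t ht 1 ⟨zero_le_one, le_rfl⟩)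
  rcases hx.1.eq_or_lt with h0 | h0
  · obtain rfl : x = 0 := h0.symm
    have hle : ∀ p ∈ A ×ˢ Icc (0 : ℝ) 1, ‖g p.1 p.2 / a p.2‖ ≤ C * D * p.2 ^ 2 := by
      rintro ⟨τ, z⟩ ⟨hτ, hz⟩
      dsimp only at hτ hz ⊢
      rcases hz.1.eq_or_lt with hz0 | hz0
      · simp [← hz0, ha0]
      · have hap := ha_pos z ⟨hz0, hz.2⟩
        rw [norm_div, Real.norm_eq_abs, Real.norm_eq_abs, abs_of_pos hap]
        calc |g τ z| / a z ≤ C * z ^ 4 / a z := by gcongr; exact hbound τ hτ z hz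
          _ = C * z ^ 2 * (z ^ 2 / a z) := by ring
          _ ≤ C * z ^ 2 * D := by gcongr; exact ha_sq z ⟨hz0, hz.2⟩
          _ = C * D * z ^ 2 := by ring
    have hlim : Filter.Tendsto (fun p : ℝ × ℝ => C * D * p.2 ^ 2)
        (nhdsWithin (t, 0) (A ×ˢ Icc 0 1)) (nhds 0) := by
      have : Continuous fun p : ℝ × ℝ => C * D * p.2 ^ 2 := by fun_prop
      simpa using (this.tendsto (t, (0 : ℝ))).mono_left nhdsWithin_le_nhds
    have := squeeze_zero_norm' (eventually_mem_nhdsWithin.mono hle) hlim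
    simpa [ContinuousWithinAt, ha0] using this
  · refine (hg (t, x) ⟨ht, hx⟩).div ?_ (ha_pos x ⟨h0, hx.2⟩).ne'
    exact (ha_cont x hx).comp continuousWithinAt_snd fun p hp => hp.2

open Set in
set_option maxHeartbeats 1000000 in
/-- Proposition 3.6: the fundamental energy estimate for classical solutions of the
degenerate beam problem. -/
theorem stmt15
    (T β γ K : ℝ) (a a' : ℝ → ℝ)
    (y yt ytt yx yxx yxxx yxxxx ytx ytxx : ℝ → ℝ → ℝ) (E : ℝ → ℝ)
    (hT : 0 < T) (hβ : 0 ≤ β) (hγ : 0 ≤ γ)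
    -- degeneracy context
    (ha_cont : ContinuousOn a (Set.Icc 0 1))
    (ha0 : a 0 = 0)
    (ha_pos : ∀ x ∈ Set.Ioc (0:ℝ) 1, 0 < a x)
    (ha_deriv : ∀ x ∈ Set.Ioc (0:ℝ) 1, HasDerivAt a (a' x) x)
    (ha'_cont : ContinuousOn a' (Set.Ioc 0 1))
    (hK0 : 0 < K) (hK2 : K < 2)
    (hKbound : ∀ x ∈ Set.Ioc (0:ℝ) 1, x * |a' x| ≤ K * a x)
    -- smoothness: all the relevant partial derivatives exist ...
    (hyt : ∀ t ∈ Set.Icc (0:ℝ) T, ∀ x ∈ Set.Icc (0:ℝ) 1,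
      HasDerivAt (fun s => y s x) (yt t x) t)
    (hytt : ∀ t ∈ Set.Icc (0:ℝ) T, ∀ x ∈ Set.Icc (0:ℝ) 1,
      HasDerivAt (fun s => yt s x) (ytt t x) t)
    (hyx : ∀ t ∈ Set.Icc (0:ℝ) T, ∀ x ∈ Set.Icc (0:ℝ) 1,
      HasDerivAt (fun ξ => y t ξ) (yx t x) x)
    (hyxx : ∀ t ∈ Set.Icc (0:ℝ) T, ∀ x ∈ Set.Icc (0:ℝ) 1,
      HasDerivAt (fun ξ => yx t ξ) (yxx t x) x)
    (hyxxx : ∀ t ∈ Set.Icc (0:ℝ) T, ∀ x ∈ Set.Icc (0:ℝ) 1,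
      HasDerivAt (fun ξ => yxx t ξ) (yxxx t x) x)
    (hyxxxx : ∀ t ∈ Set.Icc (0:ℝ) T, ∀ x ∈ Set.Icc (0:ℝ) 1,
      HasDerivAt (fun ξ => yxxx t ξ) (yxxxx t x) x)
    (hytx : ∀ t ∈ Set.Icc (0:ℝ) T, ∀ x ∈ Set.Icc (0:ℝ) 1,
      HasDerivAt (fun ξ => yt t ξ) (ytx t x) x)
    (hytxx : ∀ t ∈ Set.Icc (0:ℝ) T, ∀ x ∈ Set.Icc (0:ℝ) 1,
      HasDerivAt (fun ξ => ytx t ξ) (ytxx t x) x)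
    -- ... and are continuous on the space-time domain
    (hcont : ∀ f ∈ [y, yt, ytt, yx, yxx, yxxx, yxxxx, ytx, ytxx],
      ContinuousOn (fun p : ℝ × ℝ => f p.1 p.2) (Set.Icc (0:ℝ) T ×ˢ Set.Icc 0 1))
    -- the degenerate beam equation
    (heq : ∀ t ∈ Set.Icc (0:ℝ) T, ∀ x ∈ Set.Ioc (0:ℝ) 1,
      ytt t x + a x * yxxxx t x = 0)
    -- clamped conditions at 0, dissipative conditions at 1
    (hbc0 : ∀ t ∈ Set.Icc (0:ℝ) T, y t 0 = 0 ∧ yx t 0 = 0)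
    (hbc1 : ∀ t ∈ Set.Icc (0:ℝ) T,
      β * y t 1 - yxxx t 1 + yt t 1 = 0 ∧ γ * yx t 1 + yxx t 1 + ytx t 1 = 0)
    -- weighted Hardy inequality with constant C_HP
    (CHP : ℝ) (hCHP : 0 < CHP)
    (hHardy : ∀ v v' : ℝ → ℝ,
      (∀ x ∈ Set.Icc (0:ℝ) 1, HasDerivAt v (v' x) x) →
      ContinuousOn v' (Set.Icc 0 1) → v 0 = 0 →
      (∫ x in (0:ℝ)..1, (v x) ^ 2 / a x) ≤ CHP * ∫ x in (0:ℝ)..1, (v' x) ^ 2)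
    (hE : ∀ t, E t = (1/2) * (∫ x in (0:ℝ)..1, ((yt t x) ^ 2 / a x + (yxx t x) ^ 2))
        + (β/2) * (y t 1) ^ 2 + (γ/2) * (yx t 1) ^ 2)
    -- the constants of Proposition 3.6
    (θ ρ Cγ : ℝ)
    (hθ : θ = max (4 / a 1 + K * CHP) (1 + K/4))
    (hρ : ρ = max 2 (K/4 + 1 + 1 / a 1))
    (hCγ : Cγ = if 0 < γ then min 2 (2/γ) else 2) :
    ∀ ε₀ : ℝ, 0 < ε₀ → ε₀ ≤ 2 - K → ∀ s : ℝ, 0 < s → s < T →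
      (ε₀/2) * (∫ t in s..T, ∫ x in (0:ℝ)..1,
          ((yt t x) ^ 2 / a x + (yxx t x) ^ 2))
        ≤ (4 * θ + ρ + (Cγ/2) * (2 - K/2)) * E s
          + (K * β / 2 + K/4 + β) * (∫ t in s..T, (y t 1) ^ 2)
          + (β + 1 + 2 * γ ^ 2) * (∫ t in s..T, (yx t 1) ^ 2) := by
  intro ε₀ hε₀ hε₀K s hs hsT
  obtain ⟨cy, cyt, -, cyx, cyxx, cyxxx, cyxxxx, cytx, cytxx⟩ :
      _ ∧ _ ∧ _ ∧ _ ∧ _ ∧ _ ∧ _ ∧ _ ∧ _ := by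
    simpa only [List.forall_mem_cons, List.not_mem_nil, false_imp_iff, implies_true, and_true]
      using hcont
  have hsT' : Icc s T ⊆ Icc 0 T := Icc_subset_Icc_left hs.le
  have hsR : Icc s T ×ˢ Icc (0 : ℝ) 1 ⊆ Icc 0 T ×ˢ Icc 0 1 := prod_mono hsT' subset_rfl
  have hsmem : s ∈ Icc 0 T := ⟨hs.le, hsT.le⟩
  have hTmem : T ∈ Icc 0 T := ⟨hT.le, le_rfl⟩
  have h0 : (0 : ℝ) ∈ Icc (0 : ℝ) 1 := ⟨le_rfl, zero_le_one⟩
  have h1 : (1 : ℝ) ∈ Icc (0 : ℝ) 1 := ⟨zero_le_one, le_rfl⟩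
  have h1' : (1 : ℝ) ∈ Ioc (0 : ℝ) 1 := ⟨zero_lt_one, le_rfl⟩
  have ha1 : 0 < a 1 := ha_pos 1 h1'
  have ha_nonneg : ∀ x ∈ Icc (0 : ℝ) 1, 0 ≤ a x := fun x hx => by
    rcases hx.1.eq_or_lt with h | h
    · rw [← h, ha0]
    · exact (ha_pos x ⟨h, hx.2⟩).le
  have ha_sq : ∀ x ∈ Ioc (0 : ℝ) 1, x ^ 2 / a x ≤ 1 / a 1 := fun x hx =>
    sq_div_le_of_mul_abs_deriv_le ha_pos ha_deriv
      (fun u hu => (hKbound u hu).trans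
        (mul_le_mul_of_nonneg_right hK2.le (ha_pos u hu).le)) hx
  -- time derivatives of `yx` and `yxx`
  have dyx := hasDerivWithinAt_mixed_partial zero_lt_one hyx
    (fun x hx t ht => (hyt t ht x hx).hasDerivWithinAt) hytx cyt cytx
  have dyxx := hasDerivWithinAt_mixed_partial zero_lt_one hyxx dyx hytxx cytx cytxx
  -- boundary values at `0`
  have yt0 : ∀ t ∈ Icc 0 T, yt t 0 = 0 := fun t ht =>
    (uniqueDiffOn_Icc hT t ht).eq_deriv _ ((hyt t ht 0 h0).hasDerivWithinAt)
      ((hasDerivWithinAt_const t _ (0 : ℝ)).congr (fun u hu => (hbc0 u hu).1) (hbc0 t ht).1)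
  have ytx0 : ∀ t ∈ Icc 0 T, ytx t 0 = 0 := fun t ht =>
    (uniqueDiffOn_Icc hT t ht).eq_deriv _ (dyx 0 h0 t ht)
      ((hasDerivWithinAt_const t _ (0 : ℝ)).congr (fun u hu => (hbc0 u hu).2) (hbc0 t ht).2)
  -- vanishing rates at `0`
  obtain ⟨M, hM⟩ := (isCompact_Icc.prod isCompact_Icc).exists_bound_of_continuousOn cyxx
  obtain ⟨N, hN⟩ := (isCompact_Icc.prod isCompact_Icc).exists_bound_of_continuousOn cytxx
  have hy_bd : ∀ t ∈ Icc 0 T, ∀ x ∈ Icc (0 : ℝ) 1, |yx t x| ≤ M * x ∧ |y t x| ≤ M * x ^ 2 :=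
    fun t ht x hx => abs_le_of_deriv2_bounded (hyx t ht) (hyxx t ht) (hbc0 t ht).1 (hbc0 t ht).2
      (fun z hz => hM (t, z) ⟨ht, hz⟩) hx
  have hyt_bd : ∀ t ∈ Icc 0 T, ∀ x ∈ Icc (0 : ℝ) 1, |ytx t x| ≤ N * x ∧ |yt t x| ≤ N * x ^ 2 :=
    fun t ht x hx => abs_le_of_deriv2_bounded (hytx t ht) (hytxx t ht) (yt0 t ht) (ytx0 t ht)
      (fun z hz => hN (t, z) ⟨ht, hz⟩) hx
  have hmul_bd : ∀ {u v U V x : ℝ}, |u| ≤ U * x ^ 2 → |v| ≤ V * x ^ 2 →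
      |u * v| ≤ U * V * x ^ 4 := fun {u v U V x} hu hv => by
    rw [abs_mul]
    calc |u| * |v| ≤ (U * x ^ 2) * (V * x ^ 2) :=
          mul_le_mul hu hv (abs_nonneg _) ((abs_nonneg _).trans hu)
      _ = U * V * x ^ 4 := by ring
  have hmult_bd : ∀ {u v U x : ℝ}, 0 ≤ x → |u| ≤ U * x → |v| ≤ U * x ^ 2 →
      |2 * x * u - K / 2 * v| ≤ (2 + K / 2) * U * x ^ 2 := fun {u v U x} hx hu hv => by
    calc |2 * x * u - K / 2 * v| ≤ |2 * x * u| + |K / 2 * v| := abs_sub _ _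
      _ = 2 * x * |u| + K / 2 * |v| := by
          rw [abs_mul (2 * x), abs_mul (K / 2), abs_of_nonneg (by positivity : 0 ≤ 2 * x),
            abs_of_nonneg (by positivity : 0 ≤ K / 2)]
      _ ≤ 2 * x * (U * x) + K / 2 * (U * x ^ 2) := by gcongr
      _ = (2 + K / 2) * U * x ^ 2 := by ring
  -- continuity of the weighted integrands
  have c_yt2 : ContinuousOn (fun p : ℝ × ℝ => yt p.1 p.2 ^ 2 / a p.2) (Icc 0 T ×ˢ Icc 0 1) :=
    continuousOn_div_degenerate (g := fun t x => yt t x ^ 2) ha_cont ha0 ha_pos ha_sq (cyt.pow 2)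
      fun t ht x hx => by
        rw [sq]; exact hmul_bd (hyt_bd t ht x hx).2 (hyt_bd t ht x hx).2
  have c_y2 : ContinuousOn (fun p : ℝ × ℝ => y p.1 p.2 ^ 2 / a p.2) (Icc 0 T ×ˢ Icc 0 1) :=
    continuousOn_div_degenerate (g := fun t x => y t x ^ 2) ha_cont ha0 ha_pos ha_sq (cy.pow 2)
      fun t ht x hx => by
        rw [sq]; exact hmul_bd (hy_bd t ht x hx).2 (hy_bd t ht x hx).2
  have c_F : ContinuousOn (fun p : ℝ × ℝ =>
      yt p.1 p.2 * (2 * p.2 * yx p.1 p.2 - K / 2 * y p.1 p.2) / a p.2) (Icc 0 T ×ˢ Icc 0 1) :=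
    continuousOn_div_degenerate (g := fun t x => yt t x * (2 * x * yx t x - K / 2 * y t x))
      ha_cont ha0 ha_pos ha_sq (by fun_prop) fun t ht x hx =>
        hmul_bd (hyt_bd t ht x hx).2 (hmult_bd hx.1 (hy_bd t ht x hx).1 (hy_bd t ht x hx).2)
  have c_Q : ContinuousOn (fun p : ℝ × ℝ =>
      yt p.1 p.2 * (2 * p.2 * ytx p.1 p.2 - K / 2 * yt p.1 p.2) / a p.2)
      (Icc 0 T ×ˢ Icc 0 1) :=
    continuousOn_div_degenerate (g := fun t x => yt t x * (2 * x * ytx t x - K / 2 * yt t x))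
      ha_cont ha0 ha_pos ha_sq (by fun_prop) fun t ht x hx =>
        hmul_bd (hyt_bd t ht x hx).2 (hmult_bd hx.1 (hyt_bd t ht x hx).1 (hyt_bd t ht x hx).2)
  set F : ℝ → ℝ → ℝ := fun t x => yt t x * (2 * x * yx t x - K / 2 * y t x) / a x with hF
  set F' : ℝ → ℝ → ℝ := fun t x => -yxxxx t x * (2 * x * yx t x - K / 2 * y t x)
    + yt t x * (2 * x * ytx t x - K / 2 * yt t x) / a x with hF'
  set e : ℝ → ℝ → ℝ := fun t x => yt t x ^ 2 / a x + yxx t x ^ 2 with he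
  set e' : ℝ → ℝ → ℝ := fun t x => 2 * (yxx t x * ytxx t x - yt t x * yxxxx t x) with he'
  have c_F' : ContinuousOn (fun p : ℝ × ℝ => F' p.1 p.2) (Icc 0 T ×ˢ Icc 0 1) :=
    ContinuousOn.add (by fun_prop) c_Q
  have c_e : ContinuousOn (fun p : ℝ × ℝ => e p.1 p.2) (Icc 0 T ×ˢ Icc 0 1) :=
    c_yt2.add (cyxx.pow 2)
  have c_e' : ContinuousOn (fun p : ℝ × ℝ => e' p.1 p.2) (Icc 0 T ×ˢ Icc 0 1) := by
    fun_prop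
  have hytt_div : ∀ t ∈ Icc 0 T, ∀ x ∈ Ioc (0 : ℝ) 1, ytt t x = -(a x * yxxxx t x) :=
    fun t ht x hx => by linarith [heq t ht x hx]
  have dF : ∀ x ∈ Ioc (0 : ℝ) 1, ∀ t ∈ Icc 0 T,
      HasDerivWithinAt (fun s => F s x) (F' t x) (Icc 0 T) t := fun x hx t ht => by
    have hx' := Ioc_subset_Icc_self hx
    have hax := (ha_pos x hx).ne'
    have := ((hytt t ht x hx').hasDerivWithinAt.fun_mul (((dyx x hx' t ht).const_mul (2 * x)).fun_sub
      ((hyt t ht x hx').hasDerivWithinAt.const_mul (K / 2)))).div_const (a x)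
    refine this.congr_deriv ?_
    simp only [hF']
    rw [hytt_div t ht x hx]
    field_simp
  have de : ∀ x ∈ Ioc (0 : ℝ) 1, ∀ t ∈ Icc 0 T,
      HasDerivWithinAt (fun s => e s x) (e' t x) (Icc 0 T) t := fun x hx t ht => by
    have hx' := Ioc_subset_Icc_self hx
    have hax := (ha_pos x hx).ne'
    have := (((hytt t ht x hx').hasDerivWithinAt.fun_pow 2).div_const (a x)).fun_add
      ((dyxx x hx' t ht).fun_pow 2)
    refine this.congr_deriv ?_
    simp only [he']
    rw [hytt_div t ht x hx]
    field_simp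
    ring
  -- energy dissipation
  have int_e' : ∀ t ∈ Icc 0 T, ∫ x in (0 : ℝ)..1, e' t x
      = 2 * (ytx t 1 * yxx t 1 - yt t 1 * yxxx t 1) := fun t ht => by
    have hd : ∀ x ∈ uIcc (0 : ℝ) 1, HasDerivAt
        (fun x => 2 * (ytx t x * yxx t x - yt t x * yxxx t x)) (e' t x) x := fun x hx => by
      rw [uIcc_of_le zero_le_one] at hx
      refine ((((hytxx t ht x hx).fun_mul (hyxxx t ht x hx)).fun_sub
        ((hytx t ht x hx).fun_mul (hyxxxx t ht x hx))).const_mul 2).congr_deriv ?_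
      simp only [he']
      ring
    rw [integral_eq_sub_of_hasDerivAt hd
      ((c_e'.section_snd ht).intervalIntegrable_of_Icc zero_le_one), yt0 t ht, ytx0 t ht]
    ring
  have hbcx : ∀ t ∈ Icc 0 T, yxxx t 1 = β * y t 1 + yt t 1 := fun t ht => by
    linarith [(hbc1 t ht).1]
  have hbcxx : ∀ t ∈ Icc 0 T, yxx t 1 = -(γ * yx t 1) - ytx t 1 := fun t ht => by
    linarith [(hbc1 t ht).2]
  have trace_int : ∀ {f : ℝ → ℝ → ℝ},
      ContinuousOn (fun p : ℝ × ℝ => f p.1 p.2) (Icc 0 T ×ˢ Icc 0 1) →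
      ContinuousOn (fun t => f t 1) (Icc s T) := fun hf => (hf.section_fst h1).mono hsT'
  have cy1 := trace_int cy
  have cyt1 := trace_int cyt
  have cyx1 := trace_int cyx
  have cytx1 := trace_int cytx
  have i_y2 : IntervalIntegrable (fun t => y t 1 ^ 2) volume s T :=
    (cy1.pow 2).intervalIntegrable_of_Icc hsT.le
  have i_yx2 : IntervalIntegrable (fun t => yx t 1 ^ 2) volume s T :=
    (cyx1.pow 2).intervalIntegrable_of_Icc hsT.le
  have i_diss : IntervalIntegrable (fun t => yt t 1 ^ 2 + ytx t 1 ^ 2) volume s T :=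
    ((cyt1.pow 2).add (cytx1.pow 2)).intervalIntegrable_of_Icc hsT.le
  have i_cross : IntervalIntegrable (fun t => yx t 1 * ytx t 1) volume s T :=
    (cyx1.mul cytx1).intervalIntegrable_of_Icc hsT.le
  have trace_sq : ∀ {f f' : ℝ → ℝ}, ContinuousOn f (Icc s T) → ContinuousOn f' (Icc s T) →
      (∀ t ∈ Icc 0 T, HasDerivWithinAt f (f' t) (Icc 0 T) t) →
      ∫ t in s..T, f t * f' t = f T ^ 2 / 2 - f s ^ 2 / 2 := fun {f f'} cf cf' hf =>
    integral_eq_sub_of_hasDerivAt_of_le hsT.le (f := fun t => f t ^ 2 / 2)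
      ((cf.pow 2).div_const 2)
      (fun t ht => by
        refine ((((hf t (hsT' (Ioo_subset_Icc_self ht))).hasDerivAt
          (Icc_mem_nhds (hs.trans ht.1) ht.2)).fun_pow 2).div_const 2).congr_deriv ?_
        ring)
      ((cf.mul cf').intervalIntegrable_of_Icc hsT.le)
  have cross_eq := trace_sq cyx1 cytx1 (dyx 1 h1)
  have y_eq := trace_sq cy1 cyt1 (fun t ht => (hyt t ht 1 h1).hasDerivWithinAt)
  have dissipation : E T - E s = -∫ t in s..T, (yt t 1 ^ 2 + ytx t 1 ^ 2) := by
    have hleib := integral_sub_integral_eq_integral_deriv hsT.le zero_le_one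
      (fun t ht => c_e.section_snd (hsT' ht)) (c_e'.mono hsR)
      (fun x hx t ht => (de x hx t (hsT' ht)).mono hsT')
    have hrhs : ∫ t in s..T, ∫ x in (0 : ℝ)..1, e' t x
        = ∫ t in s..T, (-2 * (yt t 1 ^ 2 + ytx t 1 ^ 2) - 2 * β * (y t 1 * yt t 1)
          - 2 * γ * (yx t 1 * ytx t 1)) := by
      refine integral_congr fun t ht => ?_
      rw [uIcc_of_le hsT.le] at ht
      simp only [int_e' t (hsT' ht), hbcx t (hsT' ht), hbcxx t (hsT' ht)]
      ring
    have i_yyt : IntervalIntegrable (fun t => y t 1 * yt t 1) volume s T :=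
      (cy1.mul cyt1).intervalIntegrable_of_Icc hsT.le
    rw [hrhs, intervalIntegral.integral_sub
      ((i_diss.const_mul _).sub (i_yyt.const_mul _)) (i_cross.const_mul _),
      intervalIntegral.integral_sub (i_diss.const_mul _) (i_yyt.const_mul _),
      intervalIntegral.integral_const_mul, intervalIntegral.integral_const_mul,
      intervalIntegral.integral_const_mul, cross_eq, y_eq] at hleib
    rw [hE T, hE s]
    linarith
  -- the energy controls the other quantities
  have i_e : ∀ t ∈ Icc 0 T, IntervalIntegrable (e t) volume 0 1 := fun t ht =>
    (c_e.section_snd ht).intervalIntegrable_of_Icc zero_le_one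
  have i_yt2 : ∀ t ∈ Icc 0 T, IntervalIntegrable (fun x => yt t x ^ 2 / a x) volume 0 1 :=
    fun t ht => (c_yt2.section_snd (f := fun t x => yt t x ^ 2 / a x) ht).intervalIntegrable_of_Icc
      zero_le_one
  have i_yw2 : ∀ t ∈ Icc 0 T, IntervalIntegrable (fun x => y t x ^ 2 / a x) volume 0 1 :=
    fun t ht => (c_y2.section_snd (f := fun t x => y t x ^ 2 / a x) ht).intervalIntegrable_of_Icc
      zero_le_one
  have i_yxx2 : ∀ t ∈ Icc 0 T, IntervalIntegrable (fun x => yxx t x ^ 2) volume 0 1 :=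
    fun t ht => ((cyxx.section_snd ht).pow 2).intervalIntegrable_of_Icc zero_le_one
  have i_yxs2 : ∀ t ∈ Icc 0 T, IntervalIntegrable (fun x => yx t x ^ 2) volume 0 1 :=
    fun t ht => ((cyx.section_snd ht).pow 2).intervalIntegrable_of_Icc zero_le_one
  have e_split : ∀ t ∈ Icc 0 T, ∫ x in (0 : ℝ)..1, e t x
      = (∫ x in (0 : ℝ)..1, yt t x ^ 2 / a x) + ∫ x in (0 : ℝ)..1, yxx t x ^ 2 := fun t ht =>
    intervalIntegral.integral_add (i_yt2 t ht) (i_yxx2 t ht)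
  have yt2_nonneg : ∀ t, 0 ≤ ∫ x in (0 : ℝ)..1, yt t x ^ 2 / a x := fun t =>
    integral_nonneg zero_le_one fun x hx => div_nonneg (sq_nonneg _) (ha_nonneg x hx)
  have yxx2_nonneg : ∀ t, 0 ≤ ∫ x in (0 : ℝ)..1, yxx t x ^ 2 := fun t =>
    integral_nonneg zero_le_one fun x _ => sq_nonneg _
  have E_lower : ∀ t, (∫ x in (0 : ℝ)..1, e t x) ≤ 2 * E t := fun t => by
    have := hE t
    have hb : 0 ≤ β / 2 * y t 1 ^ 2 := by positivity
    have hg : 0 ≤ γ / 2 * yx t 1 ^ 2 := by positivity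
    simp only [he]
    linarith
  have e_nonneg : ∀ t ∈ Icc 0 T, 0 ≤ ∫ x in (0 : ℝ)..1, e t x := fun t ht => by
    rw [e_split t ht]; exact add_nonneg (yt2_nonneg t) (yxx2_nonneg t)
  have E_nonneg : ∀ t ∈ Icc 0 T, 0 ≤ E t := fun t ht => by
    linarith [E_lower t, e_nonneg t ht]
  have E_anti : E T ≤ E s := by
    have : 0 ≤ ∫ t in s..T, (yt t 1 ^ 2 + ytx t 1 ^ 2) :=
      integral_nonneg hsT.le fun t _ => by positivity
    linarith
  have yx_sq_le : ∀ t ∈ Icc 0 T, ∀ x ∈ Icc (0 : ℝ) 1,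
      yx t x ^ 2 ≤ ∫ ξ in (0 : ℝ)..1, yxx t ξ ^ 2 := fun t ht x hx =>
    sq_le_integral_sq_deriv (hyxx t ht) (cyxx.section_snd ht) (hbc0 t ht).2 hx
  have int_yx_sq_le : ∀ t ∈ Icc 0 T,
      ∫ x in (0 : ℝ)..1, yx t x ^ 2 ≤ ∫ x in (0 : ℝ)..1, yxx t x ^ 2 := fun t ht => by
    simpa using integral_mono_on zero_le_one (i_yxs2 t ht)
      (_root_.intervalIntegrable_const (c := ∫ x in (0 : ℝ)..1, yxx t x ^ 2)) (yx_sq_le t ht)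
  have Cγ_bound : yx s 1 ^ 2 ≤ Cγ * E s := by
    have h2 : yx s 1 ^ 2 ≤ 2 * E s := by
      linarith [yx_sq_le s hsmem 1 h1, E_lower s, e_split s hsmem, yt2_nonneg s]
    rw [hCγ]
    split_ifs with hγ0
    · rcases min_choice 2 (2 / γ) with h | h <;> rw [h]
      · exact h2
      · have := hE s
        have hb : 0 ≤ β / 2 * y s 1 ^ 2 := by positivity
        have he0 := e_nonneg s hsmem
        simp only [he] at he0
        rw [div_mul_eq_mul_div, le_div_iff₀ hγ0]
        linarith
    · exact h2
  have θ1 : 1 + K / 4 ≤ θ := hθ ▸ le_max_right _ _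
  have θ2 : 4 / a 1 + K * CHP ≤ θ := hθ ▸ le_max_left _ _
  have F_bound : ∀ t ∈ Icc 0 T, |∫ x in (0 : ℝ)..1, F t x| ≤ 2 * θ * E t := fun t ht => by
    have hpt : ∀ x ∈ Icc (0 : ℝ) 1, |F t x| ≤ (1 + K / 4) * (yt t x ^ 2 / a x)
        + 1 / a 1 * yx t x ^ 2 + K / 4 * (y t x ^ 2 / a x) := fun x hx => by
      rcases hx.1.eq_or_lt with hx0 | hx0
      · simp only [hF, ← hx0, ha0, div_zero, abs_zero, mul_zero]
        positivity
      · have hx' : x ∈ Ioc (0 : ℝ) 1 := ⟨hx0, hx.2⟩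
        have hax := ha_pos x hx'
        have hw : x ^ 2 / a x * yx t x ^ 2 ≤ 1 / a 1 * yx t x ^ 2 :=
          mul_le_mul_of_nonneg_right (ha_sq x hx') (sq_nonneg _)
        have hnum : |yt t x * (2 * x * yx t x - K / 2 * y t x)|
            ≤ (1 + K / 4) * yt t x ^ 2 + x ^ 2 * yx t x ^ 2 + K / 4 * y t x ^ 2 := by
          rw [abs_le]
          constructor
          · nlinarith [sq_nonneg (yt t x + x * yx t x),
              mul_nonneg hK0.le (sq_nonneg (yt t x - y t x))]
          · nlinarith [sq_nonneg (yt t x - x * yx t x),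
              mul_nonneg hK0.le (sq_nonneg (yt t x + y t x))]
        calc |F t x| = |yt t x * (2 * x * yx t x - K / 2 * y t x)| / a x := by
              rw [hF, abs_div, abs_of_pos hax]
          _ ≤ ((1 + K / 4) * yt t x ^ 2 + x ^ 2 * yx t x ^ 2 + K / 4 * y t x ^ 2) / a x := by
              gcongr
          _ = (1 + K / 4) * (yt t x ^ 2 / a x) + x ^ 2 / a x * yx t x ^ 2
              + K / 4 * (y t x ^ 2 / a x) := by ring
          _ ≤ _ := by gcongr
    have i1 := (i_yt2 t ht).const_mul (1 + K / 4)
    have i2 := (i_yxs2 t ht).const_mul (1 / a 1)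
    have i3 := (i_yw2 t ht).const_mul (K / 4)
    have c_Ft : ContinuousOn (F t) (Icc 0 1) := c_F.section_snd (f := F) ht
    have hle := (abs_integral_le_integral_abs zero_le_one).trans
      (integral_mono_on zero_le_one (c_Ft.abs.intervalIntegrable_of_Icc zero_le_one)
        ((i1.add i2).add i3) hpt)
    rw [intervalIntegral.integral_add (i1.add i2) i3, intervalIntegral.integral_add i1 i2,
      intervalIntegral.integral_const_mul, intervalIntegral.integral_const_mul,
      intervalIntegral.integral_const_mul] at hle
    have hH := (hHardy (y t) (yx t) (hyx t ht) (cyx.section_snd ht) (hbc0 t ht).1).trans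
      (mul_le_mul_of_nonneg_left (int_yx_sq_le t ht) hCHP.le)
    calc |∫ x in (0 : ℝ)..1, F t x|
        ≤ (1 + K / 4) * (∫ x in (0 : ℝ)..1, yt t x ^ 2 / a x)
          + 1 / a 1 * (∫ x in (0 : ℝ)..1, yxx t x ^ 2)
          + K / 4 * (CHP * ∫ x in (0 : ℝ)..1, yxx t x ^ 2) := by
          refine hle.trans ?_
          gcongr
          exact int_yx_sq_le t ht
      _ = (1 + K / 4) * (∫ x in (0 : ℝ)..1, yt t x ^ 2 / a x)
          + (4 / a 1 + K * CHP) / 4 * ∫ x in (0 : ℝ)..1, yxx t x ^ 2 := by ring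
      _ ≤ θ * (∫ x in (0 : ℝ)..1, yt t x ^ 2 / a x)
          + θ * ∫ x in (0 : ℝ)..1, yxx t x ^ 2 := by
          gcongr
          · exact yt2_nonneg t
          · exact yxx2_nonneg t
          · linarith
      _ = θ * ∫ x in (0 : ℝ)..1, e t x := by rw [e_split t ht]; ring
      _ ≤ θ * (2 * E t) := by
          gcongr
          · linarith
          · exact E_lower t
      _ = 2 * θ * E t := by ring
  -- the multiplier identity in space
  have multiplier : ∀ t ∈ Icc 0 T,
      (∫ x in (0 : ℝ)..1, F' t x) + ε₀ / 2 * (∫ x in (0 : ℝ)..1, e t x)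
        ≤ -2 * yx t 1 * yxxx t 1 + 2 * yx t 1 * yxx t 1 + yxx t 1 ^ 2
          + K / 2 * (y t 1 * yxxx t 1 - yx t 1 * yxx t 1) + yt t 1 ^ 2 / a 1 := fun t ht => by
    let G₀ : ℝ → ℝ := fun x => -2 * (x * (yx t x * yxxx t x)) + 2 * (yx t x * yxx t x)
      + x * yxx t x ^ 2 + K / 2 * (y t x * yxxx t x - yx t x * yxx t x)
    have dG₀ : ∀ x ∈ Icc (0 : ℝ) 1, HasDerivAt G₀
        (-yxxxx t x * (2 * x * yx t x - K / 2 * y t x) + (3 - K / 2) * yxx t x ^ 2) x :=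
      fun x hx => by
        have d1 := hyx t ht x hx
        have d2 := hyxx t ht x hx
        have d3 := hyxxx t ht x hx
        have d4 := hyxxxx t ht x hx
        refine ((((((hasDerivAt_id' x).fun_mul (d2.fun_mul d4)).const_mul (-2)).fun_add
          ((d2.fun_mul d3).const_mul 2)).fun_add ((hasDerivAt_id' x).fun_mul (d3.fun_pow 2))).fun_add
          (((d1.fun_mul d4).fun_sub (d2.fun_mul d3)).const_mul (K / 2))).congr_deriv ?_
        ring
    have dG : ∀ x ∈ Ioo (0 : ℝ) 1, HasDerivAt (fun x => G₀ x + x * (yt t x ^ 2 / a x))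
        (-yxxxx t x * (2 * x * yx t x - K / 2 * y t x) + (3 - K / 2) * yxx t x ^ 2
          + (yt t x ^ 2 / a x
            + x * ((2 * yt t x * ytx t x * a x - yt t x ^ 2 * a' x) / a x ^ 2))) x :=
      fun x hx => by
        have hx' := Ioo_subset_Icc_self hx
        have hx'' := Ioo_subset_Ioc_self hx
        refine ((dG₀ x hx').fun_add ((hasDerivAt_id' x).fun_mul (((hytx t ht x hx').fun_pow 2).fun_div
          (ha_deriv x hx'') (ha_pos x hx'').ne'))).congr_deriv ?_
        ring
    have cG : ContinuousOn (fun x => G₀ x + x * (yt t x ^ 2 / a x)) (Icc 0 1) :=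
      ContinuousOn.add (fun x hx => (dG₀ x hx).continuousAt.continuousWithinAt)
        (continuousOn_id.mul (c_yt2.section_snd (f := fun t x => yt t x ^ 2 / a x) ht))
    have c_F't : ContinuousOn (F' t) (Icc 0 1) := c_F'.section_snd ht
    have c_et : ContinuousOn (e t) (Icc 0 1) := c_e.section_snd ht
    have hle := integral_le_sub_of_hasDeriv_right_of_le zero_le_one cG
      (fun x hx => (dG x hx).hasDerivWithinAt) (φ := fun x => F' t x + ε₀ / 2 * e t x)
      ((c_F't.add (c_et.const_mul _)).integrableOn_Icc) fun x hx => by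
        have hx'' := Ioo_subset_Ioc_self hx
        have hax := ha_pos x hx''
        have hKa : x * a' x ≤ K * a x :=
          (mul_le_mul_of_nonneg_left (le_abs_self _) hx.1.le).trans (hKbound x hx'')
        have hw : 0 ≤ yt t x ^ 2 / a x := by positivity
        have hKw : x * a' x / a x * (yt t x ^ 2 / a x) ≤ K * (yt t x ^ 2 / a x) :=
          mul_le_mul_of_nonneg_right ((div_le_iff₀ hax).2 hKa) hw
        have hexp : x * ((2 * yt t x * ytx t x * a x - yt t x ^ 2 * a' x) / a x ^ 2)
            = yt t x * (2 * x * ytx t x - K / 2 * yt t x) / a x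
              + K / 2 * (yt t x ^ 2 / a x) - x * a' x / a x * (yt t x ^ 2 / a x) := by
          field_simp
          ring
        simp only [hF', he]
        rw [hexp]
        nlinarith [mul_nonneg (by linarith : 0 ≤ 2 - K - ε₀) hw,
          mul_nonneg (by linarith : 0 ≤ 2 - K - ε₀) (sq_nonneg (yxx t x)), sq_nonneg (yxx t x)]
    rw [intervalIntegral.integral_add (c_F't.intervalIntegrable_of_Icc zero_le_one)
      ((i_e t ht).const_mul _), intervalIntegral.integral_const_mul] at hle
    refine hle.trans (le_of_eq ?_)
    simp only [G₀, (hbc0 t ht).1, (hbc0 t ht).2]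
    ring
  have ρ1 : 2 ≤ ρ := hρ ▸ le_max_left _ _
  have ρ2 : K / 4 + 1 + 1 / a 1 ≤ ρ := hρ ▸ le_max_right _ _
  have boundary : ∀ t ∈ Icc s T,
      (∫ x in (0 : ℝ)..1, F' t x) + ε₀ / 2 * (∫ x in (0 : ℝ)..1, e t x)
        ≤ ρ * (yt t 1 ^ 2 + ytx t 1 ^ 2) - (2 - K / 2) * (yx t 1 * ytx t 1)
          + (K * β / 2 + K / 4 + β) * y t 1 ^ 2
          + (β + 1 + 2 * γ ^ 2) * yx t 1 ^ 2 := fun t ht => by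
    refine (multiplier t (hsT' ht)).trans ?_
    rw [hbcx t (hsT' ht), hbcxx t (hsT' ht)]
    have e1 := mul_nonneg hβ (sq_nonneg (yx t 1 + y t 1))
    have e2 := sq_nonneg (yx t 1 + yt t 1)
    have e3 := sq_nonneg (γ * yx t 1 - ytx t 1)
    have e4 := mul_nonneg hK0.le (sq_nonneg (y t 1 - yt t 1))
    have e5 := mul_nonneg (mul_nonneg hγ (by linarith : 0 ≤ 2 - K / 2)) (sq_nonneg (yx t 1))
    have e6 := mul_nonneg (sub_nonneg.2 ρ1) (sq_nonneg (ytx t 1))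
    have e7 := mul_nonneg (sub_nonneg.2 ρ2) (sq_nonneg (yt t 1))
    have e8 : yt t 1 ^ 2 / a 1 = 1 / a 1 * yt t 1 ^ 2 := by ring
    rw [e8]
    nlinarith
  have c_IF' := (continuousOn_intervalIntegral_of_continuousOn_rect hT.le zero_le_one c_F').mono hsT'
  have c_Ie := (continuousOn_intervalIntegral_of_continuousOn_rect hT.le zero_le_one c_e).mono hsT'
  have i_IF' := c_IF'.intervalIntegrable_of_Icc (μ := volume) hsT.le
  have i_Ie := (c_Ie.intervalIntegrable_of_Icc (μ := volume) hsT.le).const_mul (ε₀ / 2)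
  have j1 := i_diss.const_mul ρ
  have j2 := i_cross.const_mul (2 - K / 2)
  have j3 := i_y2.const_mul (K * β / 2 + K / 4 + β)
  have j4 := i_yx2.const_mul (β + 1 + 2 * γ ^ 2)
  have hint := integral_mono_on hsT.le (i_IF'.add i_Ie) (((j1.sub j2).add j3).add j4) boundary
  rw [intervalIntegral.integral_add i_IF' i_Ie,
    intervalIntegral.integral_add ((j1.sub j2).add j3) j4,
    intervalIntegral.integral_add (j1.sub j2) j3, intervalIntegral.integral_sub j1 j2,
    intervalIntegral.integral_const_mul, intervalIntegral.integral_const_mul,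
    intervalIntegral.integral_const_mul, intervalIntegral.integral_const_mul,
    intervalIntegral.integral_const_mul, cross_eq,
    ← integral_sub_integral_eq_integral_deriv hsT.le zero_le_one
      (fun t ht => c_F.section_snd (f := F) (hsT' ht)) (c_F'.mono hsR)
      (fun x hx t ht => (dF x hx t (hsT' ht)).mono hsT')] at hint
  have hθ0 : 0 ≤ θ := by linarith
  have b1 := (abs_le.1 (F_bound T hTmem)).1
  have b2 := (abs_le.1 (F_bound s hsmem)).2
  have b3 := mul_le_mul_of_nonneg_left E_anti hθ0
  have b4 := mul_nonneg (by linarith : 0 ≤ ρ) (E_nonneg T hTmem)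
  have b5 := mul_le_mul_of_nonneg_left Cγ_bound (by linarith : 0 ≤ 2 - K / 2)
  have b6 := mul_nonneg (by linarith : 0 ≤ 2 - K / 2) (sq_nonneg (yx T 1))
  have b7 : ∫ t in s..T, (yt t 1 ^ 2 + ytx t 1 ^ 2) = E s - E T := by linarith
  rw [b7] at hint
  linarith
end
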